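/- There exists an absolute constant C > 0 such that for every dimension d ≥ 1, every convex body K in ℝ^d whose center of mass is at the origin, and every ε ∈ (0, 1/2), there exists a convex polytope P with at most C^d · ε^{-(d-1)/2} vertices such that (1−ε)K ⊆ P ⊆ K. -/

import Mathlib

open scoped Pointwise
open MeasureTheory

section holo

/-- Differentiability of a parametric integral of holomorphic functions. -/
theorem holo_integral {α : Type*} [TopologicalSpace α] [MeasurableSpace α] [BorelSpace α]
    [SecondCountableTopology α]
    (μ : Measure α) (f : α → ℂ → ℂ) (hf : Continuous (Function.uncurry f))
    (hd : ∀ p, Differentiable ℂ (f p))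
    (bound : ℝ → α → ℝ) (hbi : ∀ r, 0 < r → Integrable (bound r) μ)
    (hb : ∀ r, 0 < r → ∀ p z, ‖z‖ ≤ r → ‖f p z‖ ≤ bound r p) :
    Differentiable ℂ (fun z => ∫ p, f p z ∂μ) := by
  intro z₀
  have hfm : ∀ z, AEStronglyMeasurable (fun p => f p z) μ := fun z =>
    (hf.comp (Continuous.prodMk_left z)).aestronglyMeasurable
  have key := hasDerivAt_integral_of_dominated_loc_of_deriv_le (𝕜 := ℂ) (μ := μ)
    (F := fun z p => f p z) (F' := fun z p => deriv (f p) z) (x₀ := z₀)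
    (s := Metric.ball z₀ 1) (bound := bound (‖z₀‖ + 2))
    (Metric.ball_mem_nhds _ one_pos) (Filter.Eventually.of_forall hfm) ?_ ?_ ?_
    (hbi _ (by positivity)) ?_
  · exact key.2.differentiableAt
  · refine (hbi (‖z₀‖ + 2) (by positivity)).mono' (hfm z₀) (Filter.Eventually.of_forall ?_)
    intro p
    exact hb _ (by positivity) p z₀ (by linarith)
  · have := stronglyMeasurable_deriv_with_param hf
    exact (this.comp_measurable (measurable_prodMk_right (y := z₀))).aestronglyMeasurable
  · refine Filter.Eventually.of_forall fun p z hz => ?_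
    have := Complex.norm_deriv_le_of_forall_mem_sphere_norm_le (c := z) (R := 1)
      (C := bound (‖z₀‖ + 2) p) (f := f p) one_pos (hd p).diffContOnCl ?_
    · simpa using this
    · intro w hw
      refine hb _ (by positivity) p w ?_
      have h1 : ‖w - z‖ = 1 := by simpa [dist_eq_norm] using hw
      have h2 : ‖z - z₀‖ < 1 := by simpa [dist_eq_norm] using hz
      calc ‖w‖ = ‖(w - z) + (z - z₀) + z₀‖ := by congr 1; ring
        _ ≤ ‖w - z‖ + ‖z - z₀‖ + ‖z₀‖ := norm_add₃_le
        _ ≤ _ := by linarith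
  · exact Filter.Eventually.of_forall fun p z _ => (hd p z).hasDerivAt

/-- an entire function which is constant on small reals is constant -/
theorem entire_const (J : ℂ → ℂ) (hJ : Differentiable ℂ J) (r : ℝ) (hr : 0 < r)
    (h : ∀ t : ℝ, |t| < r → J t = J 0) (z : ℂ) : J z = J 0 := by
  have h1 : J = fun _ => J 0 := by
    apply AnalyticOnNhd.eq_of_frequently_eq (z₀ := (0:ℂ)) (fun z _ => hJ.analyticAt z)
      (fun z _ => analyticAt_const)
    have h2 : Filter.Tendsto (fun t : ℝ => (t : ℂ)) (nhdsWithin 0 {0}ᶜ) (nhdsWithin 0 {0}ᶜ) := by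
      apply tendsto_nhdsWithin_of_tendsto_nhds_of_eventually_within
      · have : Filter.Tendsto (fun t : ℝ => (t : ℂ)) (nhds 0) (nhds ((0:ℝ):ℂ)) :=
          Complex.continuous_ofReal.tendsto 0
        simpa using this.mono_left nhdsWithin_le_nhds
      · filter_upwards [self_mem_nhdsWithin] with t ht
        simpa using ht
    apply h2.frequently
    apply Filter.Eventually.frequently
    have : Metric.ball (0:ℝ) r ∈ nhdsWithin (0:ℝ) {0}ᶜ :=
      mem_nhdsWithin_of_mem_nhds (Metric.ball_mem_nhds _ hr)
    filter_upwards [this] with t ht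
    exact h t (by simpa using ht)
  exact congrFun h1 z

end holo

section blocks
variable {E : Type*} [AddCommGroup E] [Module ℝ E] [FiniteDimensional ℝ E]

theorem det_block (P Q : E →ₗ[ℝ] E) :
    LinearMap.det ((LinearMap.fst ℝ E E + P ∘ₗ LinearMap.snd ℝ E E).prod
      (LinearMap.snd ℝ E E + Q ∘ₗ LinearMap.fst ℝ E E)) = LinearMap.det (1 - Q * P) := by
  classical
  let b := Module.finBasis ℝ E
  rw [← LinearMap.det_toMatrix (b.prod b), ← LinearMap.det_toMatrix b]
  have : LinearMap.toMatrix (b.prod b) (b.prod b)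
      ((LinearMap.fst ℝ E E + P ∘ₗ LinearMap.snd ℝ E E).prod
      (LinearMap.snd ℝ E E + Q ∘ₗ LinearMap.fst ℝ E E)) =
      Matrix.fromBlocks 1 (LinearMap.toMatrix b b P) (LinearMap.toMatrix b b Q) 1 := by
    ext i j
    rcases i with i | i <;> rcases j with j | j <;>
      simp [LinearMap.toMatrix_apply, Matrix.one_apply, Finsupp.single_apply, eq_comm]
  rw [this, Matrix.det_fromBlocks_one₁₁]
  congr 1
  simp [map_sub, LinearMap.toMatrix_mul, LinearMap.toMatrix_one]

end blocks

section contour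

open Complex in
/-- exponent: constant, linear and quadratic coefficients in `τ` -/
noncomputable def cA {n : ℕ} (η : ℝ) (x y : EuclideanSpace ℝ (Fin n)) : ℂ :=
  -I * (inner ℝ x y : ℝ) - (η / 2 * (‖x‖ ^ 2 + ‖y‖ ^ 2) : ℝ)

open Complex in
noncomputable def cB {n : ℕ} (η : ℝ) (x y u v : EuclideanSpace ℝ (Fin n)) : ℂ :=
  -I * (inner ℝ u y + inner ℝ x v : ℝ) - (η * (inner ℝ x u + inner ℝ y v) : ℝ)

theorem cA_shift {n : ℕ} (η : ℝ) (x y u v : EuclideanSpace ℝ (Fin n)) (t : ℝ) :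
    cA η (x + t • u) (y + t • v) = cA η x y + t * cB η x y u v + t ^ 2 * cA η u v := by
  simp only [cA, cB, ← real_inner_self_eq_norm_sq, inner_add_left, inner_add_right,
    real_inner_smul_left, real_inner_smul_right]
  rw [real_inner_comm x u, real_inner_comm y v]
  push_cast
  ring

theorem cA_re {n : ℕ} (η : ℝ) (x y : EuclideanSpace ℝ (Fin n)) :
    (cA η x y).re = - (η / 2 * (‖x‖ ^ 2 + ‖y‖ ^ 2)) := by
  rw [cA, Complex.sub_re, Complex.ofReal_re]; simp

theorem cA_norm {n : ℕ} (η : ℝ) (hη : 0 < η) (u v : EuclideanSpace ℝ (Fin n)) (ρ : ℝ)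
    (hu : ‖u‖ ≤ ρ) (hv : ‖v‖ ≤ ρ) : ‖cA η u v‖ ≤ ρ ^ 2 * (1 + η) := by
  have hρ : 0 ≤ ρ := (norm_nonneg _).trans hu
  have h1 : |inner ℝ u v| ≤ ρ ^ 2 := (abs_real_inner_le_norm u v).trans (by nlinarith [norm_nonneg u, norm_nonneg v])
  have h2 : ‖u‖ ^ 2 ≤ ρ ^ 2 := by gcongr
  have h3 : ‖v‖ ^ 2 ≤ ρ ^ 2 := by gcongr
  calc ‖cA η u v‖ ≤ ‖-Complex.I * (inner ℝ u v : ℝ)‖ + ‖((η / 2 * (‖u‖ ^ 2 + ‖v‖ ^ 2) : ℝ) : ℂ)‖ :=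
        norm_sub_le _ _
    _ = |inner ℝ u v| + (η / 2 * (‖u‖ ^ 2 + ‖v‖ ^ 2)) := by
        rw [norm_mul, norm_neg, Complex.norm_I, one_mul, Complex.norm_real, Complex.norm_real,
          Real.norm_eq_abs, Real.norm_of_nonneg (by positivity)]
    _ ≤ ρ ^ 2 * (1 + η) := by nlinarith

theorem cB_norm {n : ℕ} (η : ℝ) (hη : 0 < η) (x y u v : EuclideanSpace ℝ (Fin n)) (ρ : ℝ)
    (hu : ‖u‖ ≤ ρ) (hv : ‖v‖ ≤ ρ) : ‖cB η x y u v‖ ≤ ρ * (1 + η) * (‖x‖ + ‖y‖) := by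
  have hρ : 0 ≤ ρ := (norm_nonneg _).trans hu
  have e1 : |inner ℝ u y| ≤ ρ * ‖y‖ := (abs_real_inner_le_norm _ _).trans (by gcongr)
  have e2 : |inner ℝ x v| ≤ ρ * ‖x‖ := (abs_real_inner_le_norm _ _).trans (by rw [mul_comm]; gcongr)
  have e3 : |inner ℝ x u| ≤ ρ * ‖x‖ := (abs_real_inner_le_norm _ _).trans (by rw [mul_comm]; gcongr)
  have e4 : |inner ℝ y v| ≤ ρ * ‖y‖ := (abs_real_inner_le_norm _ _).trans (by rw [mul_comm]; gcongr)
  calc ‖cB η x y u v‖ ≤ ‖-Complex.I * (inner ℝ u y + inner ℝ x v : ℝ)‖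
        + ‖((η * (inner ℝ x u + inner ℝ y v) : ℝ) : ℂ)‖ := norm_sub_le _ _
    _ = |inner ℝ u y + inner ℝ x v| + η * |inner ℝ x u + inner ℝ y v| := by
        rw [norm_mul, norm_neg, Complex.norm_I, one_mul, Complex.norm_real, Complex.norm_real,
          Real.norm_eq_abs, Real.norm_eq_abs, abs_mul, abs_of_pos hη]
    _ ≤ (|inner ℝ u y| + |inner ℝ x v|) + η * (|inner ℝ x u| + |inner ℝ y v|) := by
        gcongr <;> exact abs_add_le _ _
    _ ≤ (ρ * ‖y‖ + ρ * ‖x‖) + η * (ρ * ‖x‖ + ρ * ‖y‖) := by gcongr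
    _ = _ := by ring

/-- the Gaussian bound -/
theorem exp_bound {n : ℕ} (η : ℝ) (hη : 0 < η) (x y u v : EuclideanSpace ℝ (Fin n)) (ρ r : ℝ)
    (hu : ‖u‖ ≤ ρ) (hv : ‖v‖ ≤ ρ) (z : ℂ) (hz : ‖z‖ ≤ r) :
    ‖Complex.exp (cA η x y + z * cB η x y u v + z ^ 2 * cA η u v)‖ ≤
      Real.exp (2 * (r * (ρ * (1 + η))) ^ 2 / η + r ^ 2 * (ρ ^ 2 * (1 + η))) *
        (Real.exp (-(η / 4) * ‖x‖ ^ 2) * Real.exp (-(η / 4) * ‖y‖ ^ 2)) := by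
  have hρ : 0 ≤ ρ := (norm_nonneg _).trans hu
  have hr : 0 ≤ r := (norm_nonneg _).trans hz
  rw [Complex.norm_exp, ← Real.exp_add, ← Real.exp_add, Real.exp_le_exp, Complex.add_re,
    Complex.add_re, cA_re]
  have h1 : (z * cB η x y u v).re ≤ r * (ρ * (1 + η)) * (‖x‖ + ‖y‖) := by
    refine (Complex.re_le_norm _).trans ?_
    rw [norm_mul, mul_assoc]
    gcongr
    exact cB_norm η hη x y u v ρ hu hv
  have h2 : (z ^ 2 * cA η u v).re ≤ r ^ 2 * (ρ ^ 2 * (1 + η)) := by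
    refine (Complex.re_le_norm _).trans ?_
    rw [norm_mul, norm_pow]
    gcongr
    exact cA_norm η hη u v ρ hu hv
  set c := r * (ρ * (1 + η)) with hc
  have h3 : ∀ s : ℝ, c * s ≤ c ^ 2 / η + η / 4 * s ^ 2 := by
    intro s
    have : c ^ 2 / η + η / 4 * s ^ 2 - c * s = (c - η / 2 * s) ^ 2 / η := by field_simp; ring
    have h4 : 0 ≤ (c - η / 2 * s) ^ 2 / η := by positivity
    linarith
  have h4 := h3 ‖x‖
  have h5 := h3 ‖y‖
  have h6 : 2 * c ^ 2 / η = c ^ 2 / η + c ^ 2 / η := by ring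
  rw [h6]
  nlinarith

/-- the complexified Jacobian -/
noncomputable def cD {n : ℕ} (P Q : EuclideanSpace ℝ (Fin n) →L[ℝ] EuclideanSpace ℝ (Fin n)) (z : ℂ) : ℂ :=
  Matrix.det (1 - z ^ 2 • (Matrix.of fun i j : Fin n =>
    ((Q (P (EuclideanSpace.single j (1 : ℝ))) i : ℝ) : ℂ)))

theorem cD_bound {n : ℕ} (P Q : EuclideanSpace ℝ (Fin n) →L[ℝ] EuclideanSpace ℝ (Fin n)) (z : ℂ)
    (L r : ℝ) (hP : ‖P‖ ≤ L) (hQ : ‖Q‖ ≤ L) (hz : ‖z‖ ≤ r) :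
    ‖cD P Q z‖ ≤ (n.factorial : ℝ) * (1 + r ^ 2 * L ^ 2) ^ n := by
  have hL : 0 ≤ L := (norm_nonneg _).trans hP
  have hr : 0 ≤ r := (norm_nonneg _).trans hz
  have := Matrix.det_le (A := (1 - z ^ 2 • (Matrix.of fun i j : Fin n =>
    ((Q (P (EuclideanSpace.single j (1 : ℝ))) i : ℝ) : ℂ)))) (abv := NormedField.toAbsoluteValue ℂ)
    (x := 1 + r ^ 2 * L ^ 2) ?_
  · simpa [cD, NormedField.toAbsoluteValue] using this
  · intro i j
    change ‖(_ : ℂ)‖ ≤ _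
    simp only [Matrix.sub_apply, Matrix.smul_apply, Matrix.of_apply, smul_eq_mul]
    refine (norm_sub_le _ _).trans ?_
    gcongr
    · rw [Matrix.one_apply]; split_ifs <;> simp
    · rw [norm_mul, norm_pow, Complex.norm_real]
      gcongr
      refine (PiLp.norm_apply_le _ i).trans ?_
      refine (Q.le_opNorm _).trans ?_
      have : ‖P (EuclideanSpace.single j (1:ℝ))‖ ≤ L := by
        refine (P.le_opNorm _).trans ?_
        simpa using hP
      rw [sq]; gcongr

theorem cD_real {n : ℕ} (P Q : EuclideanSpace ℝ (Fin n) →L[ℝ] EuclideanSpace ℝ (Fin n)) (s : ℝ) (z : ℂ)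
    (hz : z ^ 2 = s) :
    cD P Q z = (LinearMap.det (1 - s • ((Q : EuclideanSpace ℝ (Fin n) →ₗ[ℝ] EuclideanSpace ℝ (Fin n)) *
      (P : EuclideanSpace ℝ (Fin n) →ₗ[ℝ] EuclideanSpace ℝ (Fin n)))) : ℝ) := by
  rw [← LinearMap.det_toMatrix (EuclideanSpace.basisFun (Fin n) ℝ).toBasis, cD, hz]
  change _ = Complex.ofRealHom _
  rw [RingHom.map_det]
  congr 1
  ext i j
  simp [LinearMap.toMatrix_apply, Matrix.one_apply]
  split_ifs <;> simp

end contour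

section contour2
variable {n : ℕ}

theorem cA_zero_integral (η : ℝ) (hη : 0 < η) (hη1 : η ≤ 1) :
    1 ≤ ‖∫ p : EuclideanSpace ℝ (Fin n) × EuclideanSpace ℝ (Fin n), Complex.exp (cA η p.1 p.2)‖ := by
  have hintg : Integrable (fun p : EuclideanSpace ℝ (Fin n) × EuclideanSpace ℝ (Fin n) =>
      Complex.exp (cA η p.1 p.2)) := by
    have h1 : Integrable (fun x : EuclideanSpace ℝ (Fin n) => Real.exp (-(η/2) * ‖x‖ ^ 2)) := by
      have := (GaussianFourier.integrable_cexp_neg_mul_sq_norm_add (V := EuclideanSpace ℝ (Fin n))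
        (b := ((η/2 : ℝ) : ℂ)) (by simpa using hη) 0 0).norm
      refine this.congr (Filter.Eventually.of_forall fun x => ?_)
      simp only [Complex.norm_exp]
      congr 1
      have : (-((η/2 : ℝ):ℂ) * (‖x‖:ℂ) ^ 2 + 0 * ((inner ℝ 0 x : ℝ):ℂ)) = ((-(η/2) * ‖x‖ ^ 2 : ℝ) : ℂ) := by
        push_cast; ring
      rw [this, Complex.ofReal_re]
    refine (h1.mul_prod h1).mono' ?_ (Filter.Eventually.of_forall fun p => ?_)
    · apply Continuous.aestronglyMeasurable
      unfold cA
      fun_prop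
    · rw [Complex.norm_exp, cA_re, ← Real.exp_add]
      apply le_of_eq; congr 1; ring
  rw [Measure.volume_eq_prod, integral_prod_symm _ hintg]
  have h1 : ∀ y : EuclideanSpace ℝ (Fin n), ∫ x : EuclideanSpace ℝ (Fin n), Complex.exp (cA η x y) =
      ((Real.pi / ((η/2 : ℝ) : ℂ)) ^ (n / 2 : ℂ)) *
      Complex.exp (-((η/2 + 1/(2*η) : ℝ):ℂ) * ‖y‖ ^ 2) := by
    intro y
    have := GaussianFourier.integral_cexp_neg_mul_sq_norm_add (V := EuclideanSpace ℝ (Fin n))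
      (b := ((η/2 : ℝ) : ℂ)) (by simpa using hη) (-Complex.I) y
    rw [finrank_euclideanSpace_fin] at this
    have e : ∀ x : EuclideanSpace ℝ (Fin n), Complex.exp (cA η x y) =
        Complex.exp (-((η/2 : ℝ):ℂ) * ‖y‖ ^ 2) * Complex.exp (-((η/2 : ℝ):ℂ) * ‖x‖ ^ 2 + -Complex.I * (inner ℝ y x : ℝ)) := by
      intro x
      rw [← Complex.exp_add]; congr 1
      rw [cA, real_inner_comm]; push_cast; ring
    simp_rw [e]
    rw [integral_const_mul, this, mul_left_comm, ← Complex.exp_add]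
    congr 2
    have : (η:ℂ) ≠ 0 := by exact_mod_cast hη.ne'
    push_cast
    rw [neg_sq, Complex.I_sq]
    field_simp
    ring
  simp_rw [h1]
  rw [integral_const_mul]
  have h2 := GaussianFourier.integral_cexp_neg_mul_sq_norm_add (V := EuclideanSpace ℝ (Fin n))
      (b := ((η/2 + 1/(2*η) : ℝ) : ℂ)) (by rw [Complex.ofReal_re]; positivity) 0 0
  simp only [zero_mul, add_zero, finrank_euclideanSpace_fin] at h2
  rw [h2]
  have h3 : (0:ℝ) < Real.pi / (η/2) := by positivity
  have h4 : (0:ℝ) < Real.pi / (η/2 + 1/(2*η)) := by positivity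
  rw [norm_mul, norm_mul]
  rw [← Complex.ofReal_div, ← Complex.ofReal_div, show (n / 2 : ℂ) = ((n/2 : ℝ) : ℂ) by push_cast; ring,
    ← Complex.ofReal_cpow h3.le, ← Complex.ofReal_cpow h4.le, Complex.norm_real, Complex.norm_real,
    Real.norm_of_nonneg (by positivity), Real.norm_of_nonneg (by positivity)]
  simp only [norm_zero, Complex.ofReal_zero, ne_eq, OfNat.ofNat_ne_zero, not_false_eq_true, zero_pow, mul_zero, zero_div, Complex.exp_zero, norm_one, mul_one]
  rw [← Real.mul_rpow h3.le h4.le]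
  apply Real.one_le_rpow _ (by positivity)
  have : Real.pi / (η/2) * (Real.pi / (η/2 + 1/(2*η))) = 4 * Real.pi ^ 2 / (η ^ 2 + 1) := by
    field_simp; ring
  rw [this, le_div_iff₀ (by positivity)]
  nlinarith [Real.pi_gt_three]

theorem det_pos_small (P Q : EuclideanSpace ℝ (Fin n) →L[ℝ] EuclideanSpace ℝ (Fin n)) (L s : ℝ)
    (hP : ‖P‖ ≤ L) (hQ : ‖Q‖ ≤ L) (hs : 0 ≤ s) (hsL : s * L ^ 2 < 1) :
    0 < LinearMap.det (1 - s • ((Q : EuclideanSpace ℝ (Fin n) →ₗ[ℝ] EuclideanSpace ℝ (Fin n)) *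
      (P : EuclideanSpace ℝ (Fin n) →ₗ[ℝ] EuclideanSpace ℝ (Fin n)))) := by
  have hL : 0 ≤ L := (norm_nonneg _).trans hP
  set f : ℝ → ℝ := fun s => LinearMap.det (1 - s • ((Q : EuclideanSpace ℝ (Fin n) →ₗ[ℝ] EuclideanSpace ℝ (Fin n)) *
      (P : EuclideanSpace ℝ (Fin n) →ₗ[ℝ] EuclideanSpace ℝ (Fin n)))) with hf
  have hcont : Continuous f := by
    have : f = fun s => Matrix.det (1 - s • LinearMap.toMatrix (EuclideanSpace.basisFun (Fin n) ℝ).toBasis (EuclideanSpace.basisFun (Fin n) ℝ).toBasis ((Q : EuclideanSpace ℝ (Fin n) →ₗ[ℝ] EuclideanSpace ℝ (Fin n)) *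
      (P : EuclideanSpace ℝ (Fin n) →ₗ[ℝ] EuclideanSpace ℝ (Fin n)))) := by
      ext s
      rw [hf]; dsimp only
      rw [← LinearMap.det_toMatrix (EuclideanSpace.basisFun (Fin n) ℝ).toBasis, map_sub, map_smul, LinearMap.toMatrix_one]
    rw [this]
    apply Continuous.matrix_det
    fun_prop
  have hne : ∀ t, 0 ≤ t → t ≤ s → f t ≠ 0 := by
    intro t ht hts h0
    have := LinearMap.bot_lt_ker_of_det_eq_zero h0
    obtain ⟨v, hv, hv0⟩ := SetLike.exists_of_lt this
    rw [LinearMap.mem_ker] at hv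
    simp only [LinearMap.sub_apply, Module.End.one_apply, LinearMap.smul_apply, Module.End.mul_apply, ContinuousLinearMap.coe_coe] at hv
    have hv1 : v = t • Q (P v) := sub_eq_zero.mp hv
    have hv2 : ‖v‖ ≤ t * L ^ 2 * ‖v‖ := by
      conv_lhs => rw [hv1]
      rw [norm_smul, Real.norm_of_nonneg ht, mul_assoc]
      gcongr
      refine (Q.le_opNorm _).trans ?_
      have : ‖P v‖ ≤ L * ‖v‖ := (P.le_opNorm _).trans (by gcongr)
      calc ‖Q‖ * ‖P v‖ ≤ L * (L * ‖v‖) := by gcongr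
        _ = _ := by ring
    have hvpos : 0 < ‖v‖ := norm_pos_iff.mpr (by simpa using hv0)
    have : t * L ^ 2 < 1 := lt_of_le_of_lt (by gcongr) hsL
    nlinarith
  by_contra hneg
  have h0 : f 0 = 1 := by simp [hf]
  have hle : f s ≤ 0 := not_lt.mp hneg
  obtain ⟨t, ht, ht0⟩ := intermediate_value_Icc' hs hcont.continuousOn
    (show (0:ℝ) ∈ Set.Icc (f s) (f 0) from ⟨hle, by rw [h0]; norm_num⟩)
  exact hne t ht.1 ht.2 ht0

end contour2

section contour3
variable {n : ℕ}

theorem haar_prod : (volume : Measure (EuclideanSpace ℝ (Fin n) × EuclideanSpace ℝ (Fin n))).IsAddHaarMeasure := by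
  rw [Measure.volume_eq_prod]; infer_instance

/-- the integrand on the contour -/
noncomputable def cF (η : ℝ) (a b : EuclideanSpace ℝ (Fin n) → EuclideanSpace ℝ (Fin n))
    (p : EuclideanSpace ℝ (Fin n) × EuclideanSpace ℝ (Fin n)) (z : ℂ) : ℂ :=
  Complex.exp (cA η p.1 p.2 + z * cB η p.1 p.2 (a p.2) (b p.1) + z ^ 2 * cA η (a p.2) (b p.1)) *
    cD (fderiv ℝ a p.2) (fderiv ℝ b p.1) z

theorem cF_cont (η : ℝ) (a b : EuclideanSpace ℝ (Fin n) → EuclideanSpace ℝ (Fin n))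
    (ha : ContDiff ℝ 1 a) (hb : ContDiff ℝ 1 b) : Continuous (Function.uncurry (cF η a b)) := by
  have ha0 := ha.continuous
  have hb0 := hb.continuous
  have ha1 := ha.continuous_fderiv one_ne_zero
  have hb1 := hb.continuous_fderiv one_ne_zero
  unfold Function.uncurry cF
  apply Continuous.mul
  · unfold cA cB
    fun_prop
  · unfold cD
    apply Continuous.matrix_det
    apply Continuous.sub continuous_const
    refine Continuous.fun_smul (by fun_prop) ?_
    apply continuous_matrix
    intro i j
    apply Complex.continuous_ofReal.comp
    apply (EuclideanSpace.proj (𝕜 := ℝ) i).continuous.comp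
    apply Continuous.clm_apply
    · exact hb1.comp (by fun_prop)
    · apply Continuous.clm_apply
      · exact ha1.comp (by fun_prop)
      · fun_prop

theorem cD_diff (P Q : EuclideanSpace ℝ (Fin n) →L[ℝ] EuclideanSpace ℝ (Fin n)) :
    Differentiable ℂ (cD P Q) := by
  have : cD P Q = fun z => cD P Q z := rfl
  rw [this]
  simp only [cD, Matrix.det_apply]
  refine Differentiable.fun_sum fun σ _ => ?_
  apply Differentiable.const_smul
  refine Differentiable.fun_finsetProd fun i _ => ?_
  simp only [Matrix.sub_apply, Matrix.smul_apply]
  fun_prop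

theorem cF_diff (η : ℝ) (a b : EuclideanSpace ℝ (Fin n) → EuclideanSpace ℝ (Fin n)) 
    (p : EuclideanSpace ℝ (Fin n) × EuclideanSpace ℝ (Fin n)) : Differentiable ℂ (cF η a b p) := by
  apply Differentiable.mul
  · fun_prop
  · exact cD_diff _ _

theorem gauss_int (η : ℝ) (hη : 0 < η) :
    Integrable (fun x : EuclideanSpace ℝ (Fin n) => Real.exp (-(η/4) * ‖x‖ ^ 2)) := by
  have := (GaussianFourier.integrable_cexp_neg_mul_sq_norm_add (V := EuclideanSpace ℝ (Fin n))
    (b := ((η/4 : ℝ) : ℂ)) (by simpa using hη) 0 0).norm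
  refine this.congr (Filter.Eventually.of_forall fun x => ?_)
  simp only [Complex.norm_exp]
  congr 1
  have : (-((η/4 : ℝ):ℂ) * (‖x‖:ℂ) ^ 2 + 0 * ((inner ℝ 0 x : ℝ):ℂ)) = ((-(η/4) * ‖x‖ ^ 2 : ℝ) : ℂ) := by
    push_cast; ring
  rw [this, Complex.ofReal_re]

theorem cF_int_diff (η : ℝ) (hη : 0 < η) (a b : EuclideanSpace ℝ (Fin n) → EuclideanSpace ℝ (Fin n))
    (ha : ContDiff ℝ 1 a) (hb : ContDiff ℝ 1 b) (L : NNReal) (haL : LipschitzWith L a)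
    (hbL : LipschitzWith L b) (ρ : ℝ) (haρ : ∀ y, ‖a y‖ ≤ ρ) (hbρ : ∀ x, ‖b x‖ ≤ ρ) :
    Differentiable ℂ (fun z => ∫ p, cF η a b p z) := by
  refine holo_integral volume (cF η a b) (cF_cont η a b ha hb) (cF_diff η a b)
    (fun r p => (Real.exp (2 * (r * (ρ * (1 + η))) ^ 2 / η + r ^ 2 * (ρ ^ 2 * (1 + η))) *
        (Real.exp (-(η / 4) * ‖p.1‖ ^ 2) * Real.exp (-(η / 4) * ‖p.2‖ ^ 2))) *
        ((n.factorial : ℝ) * (1 + r ^ 2 * L ^ 2) ^ n)) ?_ ?_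
  · intro r hr
    apply Integrable.mul_const
    apply Integrable.const_mul
    exact (gauss_int η hη).mul_prod (gauss_int η hη)
  · intro r hr p z hz
    rw [cF, norm_mul]
    gcongr
    · exact exp_bound η hη _ _ _ _ ρ r (haρ _) (hbρ _) z hz
    · exact cD_bound _ _ z L r (norm_fderiv_le_of_lipschitz ℝ haL) (norm_fderiv_le_of_lipschitz ℝ hbL) hz

/-- derivative of the shear map -/
noncomputable def cM (P Q : EuclideanSpace ℝ (Fin n) →L[ℝ] EuclideanSpace ℝ (Fin n)) :
    (EuclideanSpace ℝ (Fin n) × EuclideanSpace ℝ (Fin n)) →L[ℝ]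
    (EuclideanSpace ℝ (Fin n) × EuclideanSpace ℝ (Fin n)) :=
  (ContinuousLinearMap.fst ℝ _ _ + P ∘L ContinuousLinearMap.snd ℝ _ _).prod
      (ContinuousLinearMap.snd ℝ _ _ + Q ∘L ContinuousLinearMap.fst ℝ _ _)

theorem cM_det (P Q : EuclideanSpace ℝ (Fin n) →L[ℝ] EuclideanSpace ℝ (Fin n)) :
    (cM P Q).det = LinearMap.det (1 - (Q : EuclideanSpace ℝ (Fin n) →ₗ[ℝ] EuclideanSpace ℝ (Fin n)) *
      (P : EuclideanSpace ℝ (Fin n) →ₗ[ℝ] EuclideanSpace ℝ (Fin n))) := by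
  rw [← det_block]; rfl

theorem cM_deriv (a b : EuclideanSpace ℝ (Fin n) → EuclideanSpace ℝ (Fin n))
    (ha : ContDiff ℝ 1 a) (hb : ContDiff ℝ 1 b) (s t : ℝ)
    (p : EuclideanSpace ℝ (Fin n) × EuclideanSpace ℝ (Fin n)) :
    HasFDerivAt (fun p : EuclideanSpace ℝ (Fin n) × EuclideanSpace ℝ (Fin n) =>
      (p.1 + s • a p.2, p.2 + t • b p.1)) (cM (s • fderiv ℝ a p.2) (t • fderiv ℝ b p.1)) p := by
  have ha1 : HasFDerivAt a (fderiv ℝ a p.2) p.2 := (ha.differentiable one_ne_zero p.2).hasFDerivAt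
  have hb1 : HasFDerivAt b (fderiv ℝ b p.1) p.1 := (hb.differentiable one_ne_zero p.1).hasFDerivAt
  apply HasFDerivAt.prodMk
  · exact hasFDerivAt_fst.add ((ha1.comp p hasFDerivAt_snd).const_smul s)
  · exact hasFDerivAt_snd.add ((hb1.comp p hasFDerivAt_fst).const_smul t)

theorem shear_bij (a b : EuclideanSpace ℝ (Fin n) → EuclideanSpace ℝ (Fin n)) (L : NNReal) (haL : LipschitzWith L a)
    (hbL : LipschitzWith L b) (t : ℝ) (ht : |t| * L < 1) :
    Function.Bijective (fun p : EuclideanSpace ℝ (Fin n) × EuclideanSpace ℝ (Fin n) =>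
      (p.1 + t • a p.2, p.2 + t • b p.1)) := by
  have hlip : ∀ q : EuclideanSpace ℝ (Fin n) × EuclideanSpace ℝ (Fin n),
      ContractingWith (‖t‖₊ * L) (fun p : EuclideanSpace ℝ (Fin n) × EuclideanSpace ℝ (Fin n) =>
      (q.1 - t • a p.2, q.2 - t • b p.1)) := by
    intro q
    refine ⟨?_, ?_⟩
    · rw [← NNReal.coe_lt_coe]; simpa using ht
    · apply LipschitzWith.of_dist_le_mul
      intro p p'
      rw [Prod.dist_eq]
      push_cast
      simp only [dist_sub_left, dist_smul₀]
      have h1 := haL.dist_le_mul p.2 p'.2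
      have h2 := hbL.dist_le_mul p.1 p'.1
      have h3 : dist p.2 p'.2 ≤ dist p p' := le_max_right _ _
      have h4 : dist p.1 p'.1 ≤ dist p p' := le_max_left _ _
      apply max_le
      · calc _ ≤ ‖t‖ * (L * dist p.2 p'.2) := by gcongr
          _ ≤ ‖t‖ * (L * dist p p') := by gcongr
          _ = _ := by ring
      · calc _ ≤ ‖t‖ * (L * dist p.1 p'.1) := by gcongr
          _ ≤ ‖t‖ * (L * dist p p') := by gcongr
          _ = _ := by ring
  constructor
  · intro p p' h
    simp only [Prod.mk.injEq] at h
    have f1 : Function.IsFixedPt (fun r : EuclideanSpace ℝ (Fin n) × EuclideanSpace ℝ (Fin n) =>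
      ((p.1 + t • a p.2) - t • a r.2, (p.2 + t • b p.1) - t • b r.1)) p := by
      simp [Function.IsFixedPt]
    have f2 : Function.IsFixedPt (fun r : EuclideanSpace ℝ (Fin n) × EuclideanSpace ℝ (Fin n) =>
      ((p.1 + t • a p.2) - t • a r.2, (p.2 + t • b p.1) - t • b r.1)) p' := by
      rw [h.1, h.2]
      simp [Function.IsFixedPt]
    exact (hlip (p.1 + t • a p.2, p.2 + t • b p.1)).fixedPoint_unique' f1 f2
  · intro q
    have := (hlip q).fixedPoint_isFixedPt
    set p := (hlip q).fixedPoint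
    refine ⟨p, ?_⟩
    have h1 := congrArg Prod.fst this
    have h2 := congrArg Prod.snd this
    simp only at h1 h2
    ext1
    · simp only; nth_rw 1 [← h1]; simp
    · simp only; nth_rw 1 [← h2]; simp

theorem cF_int_const (η : ℝ) (a b : EuclideanSpace ℝ (Fin n) → EuclideanSpace ℝ (Fin n))
    (ha : ContDiff ℝ 1 a) (hb : ContDiff ℝ 1 b) (L : NNReal) (haL : LipschitzWith L a)
    (hbL : LipschitzWith L b) (t : ℝ) (ht : |t| * L < 1) :
    ∫ p, cF η a b p t = ∫ p : EuclideanSpace ℝ (Fin n) × EuclideanSpace ℝ (Fin n), Complex.exp (cA η p.1 p.2) := by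
  have hbij := shear_bij a b L haL hbL t ht
  have haar := haar_prod (n := n)
  have := integral_image_eq_integral_abs_det_fderiv_smul (volume : Measure (EuclideanSpace ℝ (Fin n) × EuclideanSpace ℝ (Fin n)))
    (s := Set.univ) MeasurableSet.univ (fun p _ => (cM_deriv a b ha hb t t p).hasFDerivWithinAt)
    hbij.1.injOn (fun p => Complex.exp (cA η p.1 p.2))
  rw [Set.image_univ, hbij.2.range_eq, setIntegral_univ, setIntegral_univ] at this
  rw [this]
  congr 1
  ext p
  have e : (cM (t • fderiv ℝ a p.2) (t • fderiv ℝ b p.1)).det = 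
      LinearMap.det (1 - (t^2) • (((fderiv ℝ b p.1) : EuclideanSpace ℝ (Fin n) →ₗ[ℝ] EuclideanSpace ℝ (Fin n)) *
      ((fderiv ℝ a p.2) : EuclideanSpace ℝ (Fin n) →ₗ[ℝ] EuclideanSpace ℝ (Fin n)))) := by
    rw [cM_det]
    congr 2
    rw [ContinuousLinearMap.toLinearMap_smul, ContinuousLinearMap.toLinearMap_smul, smul_mul_smul_comm, sq]
  have hpos := det_pos_small (fderiv ℝ a p.2) (fderiv ℝ b p.1) L (t^2) 
    (norm_fderiv_le_of_lipschitz ℝ haL) (norm_fderiv_le_of_lipschitz ℝ hbL) (by positivity) (by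
      rw [← mul_pow, ← sq_abs, abs_mul, NNReal.abs_eq]
      exact pow_lt_one₀ (by positivity) ht (by norm_num))
  rw [e, abs_of_pos hpos, cA_shift, cF, cD_real _ _ (t^2) t (by push_cast; rfl), mul_comm, Complex.real_smul]

theorem contour_bound (η : ℝ) (hη : 0 < η) (hη1 : η ≤ 1) (a b : EuclideanSpace ℝ (Fin n) → EuclideanSpace ℝ (Fin n))
    (ha : ContDiff ℝ 1 a) (hb : ContDiff ℝ 1 b) (L : NNReal) (haL : LipschitzWith L a)
    (hbL : LipschitzWith L b) (ρ : ℝ) (haρ : ∀ y, ‖a y‖ ≤ ρ) (hbρ : ∀ x, ‖b x‖ ≤ ρ) :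
    1 ≤ ∫⁻ p : EuclideanSpace ℝ (Fin n) × EuclideanSpace ℝ (Fin n), 
      ENNReal.ofReal |(cM (fderiv ℝ a p.2) (-fderiv ℝ b p.1)).det| *
      ENNReal.ofReal (Real.exp (η * ρ ^ 2 - inner ℝ p.1 (b p.1) - inner ℝ p.2 (a p.2))) := by
  have h1 : ∫ p, cF η a b p (-Complex.I) = ∫ p : EuclideanSpace ℝ (Fin n) × EuclideanSpace ℝ (Fin n), Complex.exp (cA η p.1 p.2) := by
    have h0 := cF_int_const η a b ha hb L haL hbL 0 (by simp)
    rw [← h0]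
    refine entire_const _ (cF_int_diff η hη a b ha hb L haL hbL ρ haρ hbρ) (1/((L:ℝ)+1)) (by positivity) ?_ _
    intro t ht
    rw [cF_int_const η a b ha hb L haL hbL t ?_]
    · rw [← h0]; simp
    · rw [lt_div_iff₀ (by positivity)] at ht
      nlinarith [abs_nonneg t, L.2]
  have h2 := cA_zero_integral (n := n) η hη hη1
  rw [← h1] at h2
  have h3 : (1:ENNReal) ≤ ‖∫ p, cF η a b p (-Complex.I)‖ₑ := by
    rw [← ofReal_norm]
    exact ENNReal.one_le_ofReal.mpr h2
  refine h3.trans ((enorm_integral_le_lintegral_enorm _).trans ?_)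
  apply lintegral_mono
  intro p
  simp only
  rw [← ENNReal.ofReal_mul (abs_nonneg _), ← ofReal_norm]
  apply ENNReal.ofReal_le_ofReal
  rw [cF, norm_mul, mul_comm, cD_real _ _ (-1) _ (by simp), Complex.norm_real, Real.norm_eq_abs, cM_det]
  have e : (-1:ℝ) • (((fderiv ℝ b p.1) : EuclideanSpace ℝ (Fin n) →ₗ[ℝ] EuclideanSpace ℝ (Fin n)) *
      ((fderiv ℝ a p.2) : EuclideanSpace ℝ (Fin n) →ₗ[ℝ] EuclideanSpace ℝ (Fin n))) = 
      ((-fderiv ℝ b p.1 : EuclideanSpace ℝ (Fin n) →L[ℝ] EuclideanSpace ℝ (Fin n)) : EuclideanSpace ℝ (Fin n) →ₗ[ℝ] EuclideanSpace ℝ (Fin n)) *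
      ((fderiv ℝ a p.2) : EuclideanSpace ℝ (Fin n) →ₗ[ℝ] EuclideanSpace ℝ (Fin n)) := by
    rw [ContinuousLinearMap.toLinearMap_neg, neg_mul, neg_smul, one_smul]
  rw [e]
  gcongr
  rw [Complex.norm_exp, Real.exp_le_exp, Complex.add_re, Complex.add_re, cA_re]
  have e2 : ((-Complex.I)^2 * cA η (a p.2) (b p.1)).re = η / 2 * (‖a p.2‖ ^ 2 + ‖b p.1‖ ^ 2) := by
    rw [neg_sq, Complex.I_sq, neg_one_mul, Complex.neg_re, cA_re, neg_neg]
  have e3 : (-Complex.I * cB η p.1 p.2 (a p.2) (b p.1)).re = - (inner ℝ (a p.2) p.2 + inner ℝ p.1 (b p.1)) := by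
    rw [cB, mul_sub, ← mul_assoc]
    rw [show -Complex.I * -Complex.I = ((-1 : ℝ):ℂ) by simp, ← Complex.ofReal_mul, Complex.sub_re, Complex.ofReal_re, mul_comm (-Complex.I), Complex.re_ofReal_mul]
    simp
  rw [e2, e3, real_inner_comm p.2 (a p.2)]
  have e4 : ‖a p.2‖ ^ 2 ≤ ρ ^ 2 := by gcongr; exact haρ _
  have e5 : ‖b p.1‖ ^ 2 ≤ ρ ^ 2 := by gcongr; exact hbρ _
  nlinarith [sq_nonneg ‖p.1‖, sq_nonneg ‖p.2‖]

end contour3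

section mollify
variable {n : ℕ}

theorem subgrad_ineq {E : Type*} [NormedAddCommGroup E] [NormedSpace ℝ E] (φ : E → ℝ)
    (hφ : ConvexOn ℝ Set.univ φ) (x v : E) (φ' : E →L[ℝ] ℝ) (h : HasFDerivAt φ φ' x) :
    φ' v ≤ φ (x + v) - φ x := by
  have h1 : ConvexOn ℝ Set.univ (φ ∘ (AffineMap.lineMap x (x + v) : ℝ →ᵃ[ℝ] E)) := by
    simpa using hφ.comp_affineMap (AffineMap.lineMap x (x + v) : ℝ →ᵃ[ℝ] E)
  have h2 : HasDerivAt (φ ∘ (AffineMap.lineMap x (x + v) : ℝ →ᵃ[ℝ] E)) (φ' v) 0 := by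
    have h3 : HasDerivAt (AffineMap.lineMap x (x + v) : ℝ →ᵃ[ℝ] E) ((x + v) - x) 0 :=
      AffineMap.hasDerivAt_lineMap
    rw [add_sub_cancel_left] at h3
    have h4 : HasFDerivAt φ φ' ((AffineMap.lineMap x (x + v) : ℝ →ᵃ[ℝ] E) 0) := by simpa using h
    exact h4.comp_hasDerivAt 0 h3
  have := h1.le_slope_of_hasDerivAt (Set.mem_univ 0) (Set.mem_univ 1) one_pos h2
  simpa [slope_def_field] using this

theorem conv_lip {F G : Type*} [NormedAddCommGroup F] [NormedSpace ℝ F] [NormedAddCommGroup G] [NormedSpace ℝ G]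
    (f : EuclideanSpace ℝ (Fin n) → F) (hc2 : Continuous f) (hc1 : HasCompactSupport f)
    (N : EuclideanSpace ℝ (Fin n) → ℝ) (hcont : Continuous N) (M : ℝ) (hM : 0 < M)
    (hdiff : ∀ x y, |N x - N y| ≤ M * ‖x - y‖) (T : F →L[ℝ] ℝ →L[ℝ] G) :
    ∃ L : NNReal, LipschitzWith L (convolution f N T volume) := by
  have hex2 : ∀ x, Integrable (fun t => T (f t) (N (x - t))) := fun x =>
    (hc1.convolutionExists_left T hc2 hcont.locallyIntegrable) x
  have hi : Integrable (fun t => ‖f t‖) := (hc2.integrable_of_hasCompactSupport hc1).norm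
  have hnn : 0 ≤ ‖T‖ * M * ∫ t, ‖f t‖ := by positivity
  refine ⟨⟨‖T‖ * M * ∫ t, ‖f t‖, hnn⟩, LipschitzWith.of_dist_le_mul fun x y => ?_⟩
  rw [dist_eq_norm, dist_eq_norm, convolution_def, convolution_def, ← integral_sub (hex2 x) (hex2 y)]
  refine (norm_integral_le_of_norm_le ((hi.const_mul (‖T‖ * M)).mul_const ‖x - y‖) (Filter.Eventually.of_forall fun t => ?_)).trans ?_
  · rw [← map_sub]
    refine (T.le_opNorm₂ _ _).trans ?_
    have := hdiff (x - t) (y - t)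
    rw [sub_sub_sub_cancel_right, ← Real.norm_eq_abs] at this
    calc _ ≤ ‖T‖ * ‖f t‖ * (M * ‖x - y‖) := by gcongr
      _ = _ := by ring
  · rw [integral_mul_const, integral_const_mul]
    exact le_of_eq rfl

set_option maxHeartbeats 1000000 in
open ContinuousLinearMap in
theorem mollify (N : EuclideanSpace ℝ (Fin n) → ℝ) (hN : ConvexOn ℝ Set.univ N)
    (hsub : ∀ x y, N (x + y) ≤ N x + N y) (M : ℝ) (hM : 0 < M) (hNM : ∀ x, N x ≤ M * ‖x‖)
    (κ : ℝ) (hκ : 0 < κ) :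
    ∃ b : EuclideanSpace ℝ (Fin n) → EuclideanSpace ℝ (Fin n), ContDiff ℝ 1 b ∧
      (∃ L : NNReal, LipschitzWith L b) ∧ (∀ x v, inner ℝ (b x) v ≤ N v) ∧
      (∀ x, N x - 2 * κ ≤ inner ℝ (b x) x) ∧
      (∀ x x', 0 ≤ inner ℝ (b x - b x') (x - x')) ∧
      (∀ x x', inner ℝ (b x - b x') (x - x') = 0 → b x = b x') := by
  have hdiff : ∀ x y, |N x - N y| ≤ M * ‖x - y‖ := by
    intro x y
    rw [abs_sub_le_iff]
    constructor
    · have := hsub (x - y) y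
      rw [sub_add_cancel] at this
      linarith [hNM (x - y)]
    · have := hsub (y - x) x
      rw [sub_add_cancel] at this
      have h2 := hNM (y - x)
      rw [norm_sub_rev] at h2
      linarith
  have hcont : Continuous N := by
    have : LipschitzWith ⟨M, hM.le⟩ N := LipschitzWith.of_dist_le_mul fun x y => by
      rw [Real.dist_eq, dist_eq_norm]; exact hdiff x y
    exact this.continuous
  have hloc : LocallyIntegrable N volume := hcont.locallyIntegrable
  have hδ : 0 < κ / M := by positivity
  let B : ContDiffBump (0 : EuclideanSpace ℝ (Fin n)) := ⟨κ / M / 2, κ / M, by positivity, by linarith⟩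
  set r : EuclideanSpace ℝ (Fin n) → ℝ := B.normed volume with hr
  have hr0 : ∀ t, 0 ≤ r t := fun t => B.nonneg_normed t
  have hr1 : ∫ t, r t = 1 := B.integral_normed
  have hrc : HasCompactSupport r := B.hasCompactSupport_normed
  have hrd : ContDiff ℝ 2 r := B.contDiff_normed (n := 2)
  have hri : Integrable r := B.integrable_normed
  have hrs : ∀ t, r t ≠ 0 → ‖t‖ < κ / M := by
    intro t ht
    have : t ∈ Function.support (B.normed volume) := ht
    rw [B.support_normed_eq] at this
    simpa using this
  set φ : EuclideanSpace ℝ (Fin n) → ℝ := convolution r N (lsmul ℝ ℝ) volume with hφdef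
  have hex : ∀ x, Integrable (fun t => r t * N (x - t)) := fun x =>
    (hrc.convolutionExists_left (lsmul ℝ ℝ) hrd.continuous hloc) x
  have hφe : ∀ x, φ x = ∫ t, r t * N (x - t) := fun x => rfl
  have hφd : ContDiff ℝ 2 φ := hrc.contDiff_convolution_left (n := 2) (lsmul ℝ ℝ) hrd hloc
  have hφc : ConvexOn ℝ Set.univ φ := by
    refine ⟨convex_univ, fun x _ y _ s t hs ht hst => ?_⟩
    rw [hφe, hφe, hφe, smul_eq_mul, smul_eq_mul, ← integral_const_mul, ← integral_const_mul,
      ← integral_add ((hex x).const_mul s) ((hex y).const_mul t)]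
    apply integral_mono (hex _) (((hex x).const_mul s).add ((hex y).const_mul t))
    intro u
    have h1 := hN.2 (Set.mem_univ (x - u)) (Set.mem_univ (y - u)) hs ht hst
    have h2 : s • (x - u) + t • (y - u) = s • x + t • y - u := by
      rw [smul_sub, smul_sub, sub_add_sub_comm, ← add_smul, hst, one_smul]
    rw [h2, smul_eq_mul, smul_eq_mul] at h1
    simp only [Pi.add_apply]
    calc _ ≤ r u * (s * N (x - u) + t * N (y - u)) := by gcongr; exact hr0 u
      _ = _ := by ring
  have hφv : ∀ x v, φ (x + v) - φ x ≤ N v := by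
    intro x v
    have h1 : φ x + N v = ∫ t, (r t * N (x - t) + r t * N v) := by
      rw [integral_add (hex x) (hri.mul_const _), integral_mul_const, hr1, one_mul, hφe]
    have h2 : φ (x + v) ≤ φ x + N v := by
      rw [h1, hφe]
      apply integral_mono (hex _) ((hex x).add (hri.mul_const _))
      intro t
      simp only [Pi.add_apply]
      rw [← mul_add]
      have := hsub (x - t) v
      rw [show x - t + v = x + v - t by abel] at this
      exact mul_le_mul_of_nonneg_left this (hr0 t)
    linarith
  have hφκ : ∀ x, |φ x - N x| ≤ κ := by
    intro x
    have h1 : φ x - N x = ∫ t, r t * (N (x - t) - N x) := by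
      simp_rw [mul_sub]
      rw [integral_sub (hex x) (hri.mul_const _), integral_mul_const, hr1, one_mul, hφe]
    rw [h1, ← Real.norm_eq_abs]
    refine (norm_integral_le_of_norm_le (hri.mul_const κ) (Filter.Eventually.of_forall fun t => ?_)).trans ?_
    · rw [norm_mul, Real.norm_of_nonneg (hr0 t)]
      by_cases h0 : r t = 0
      · simp [h0]
      · have h3 := hrs t h0
        have h4 := hdiff (x - t) x
        rw [show x - t - x = -t by abel, norm_neg] at h4
        have : M * ‖t‖ ≤ κ := by
          rw [lt_div_iff₀ hM] at h3; linarith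
        exact mul_le_mul_of_nonneg_left (h4.trans this) (hr0 t)
    · rw [integral_mul_const, hr1, one_mul]
  -- the gradient
  have hfd : ∀ x, HasFDerivAt φ (fderiv ℝ φ x) x := fun x =>
    (hφd.differentiable (by norm_num) x).hasFDerivAt
  have hlip : ∃ L : NNReal, LipschitzWith L (fderiv ℝ φ) := by
    have hrd1 : ContDiff ℝ 1 r := hrd.of_le (by norm_num)
    have hc1 : HasCompactSupport (fderiv ℝ r) := hrc.fderiv (𝕜 := ℝ)
    have hc2 : Continuous (fderiv ℝ r) := hrd1.continuous_fderiv one_ne_zero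
    have e : fderiv ℝ φ = convolution (fderiv ℝ r) N ((lsmul ℝ ℝ).precompL (EuclideanSpace ℝ (Fin n))) volume :=
      funext fun x => (hrc.hasFDerivAt_convolution_left (lsmul ℝ ℝ) hrd1 hloc x).fderiv
    rw [e]
    exact conv_lip _ hc2 hc1 N hcont M hM hdiff _
  let D := (InnerProductSpace.toDual ℝ (EuclideanSpace ℝ (Fin n)))
  let b : EuclideanSpace ℝ (Fin n) → EuclideanSpace ℝ (Fin n) := fun x => D.symm (fderiv ℝ φ x)
  have hbv : ∀ x v, inner ℝ (b x) v = fderiv ℝ φ x v := fun x v =>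
    InnerProductSpace.toDual_symm_apply
  have hsg : ∀ x v, inner ℝ (b x) v ≤ φ (x + v) - φ x := fun x v => by
    rw [hbv]; exact subgrad_ineq φ hφc x v _ (hfd x)
  refine ⟨b, ?_, ?_, ?_, ?_, ?_, ?_⟩
  · exact D.symm.toContinuousLinearEquiv.contDiff.comp (hφd.fderiv_right (m := 1) (by norm_num))
  · obtain ⟨L, hL⟩ := hlip
    exact ⟨1 * L, D.symm.lipschitz.comp hL⟩
  · intro x v
    exact (hsg x v).trans (hφv x v)
  · intro x
    have h1 := hsg x (-x)
    rw [inner_neg_right, add_neg_cancel] at h1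
    have h2 := abs_le.mp (hφκ x)
    have h3 := abs_le.mp (hφκ 0)
    have h4 := hNM 0
    rw [norm_zero, mul_zero] at h4
    linarith
  · intro x x'
    have h1 := hsg x (x' - x)
    have h2 := hsg x' (x - x')
    rw [add_sub_cancel] at h1 h2
    rw [← neg_sub x x', inner_neg_right] at h1
    rw [inner_sub_left]
    linarith
  · intro x x' h0
    have h1 := hsg x (x' - x)
    have h2 := hsg x' (x - x')
    rw [add_sub_cancel] at h1 h2
    rw [← neg_sub x x', inner_neg_right] at h1
    rw [inner_sub_left] at h0
    have h3 : φ x' - φ x = - inner ℝ (b x) (x - x') := by linarith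
    have hmin : IsLocalMin (fun z => φ z - inner ℝ (b x) z) x' := by
      apply Filter.Eventually.of_forall
      intro z
      have h4 := hsg x (z - x)
      rw [add_sub_cancel, inner_sub_right] at h4
      rw [inner_sub_right] at h3
      simp only
      linarith
    have hd : HasFDerivAt (fun z => φ z - inner ℝ (b x) z) (fderiv ℝ φ x' - fderiv ℝ φ x) x' := by
      have e : (fun z => φ z - inner ℝ (b x) z) = fun z => φ z - fderiv ℝ φ x z := by
        ext z; rw [hbv]
      rw [e]
      exact (hfd x').sub (fderiv ℝ φ x).hasFDerivAt
    have := hmin.hasFDerivAt_eq_zero hd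
    change D.symm _ = D.symm _
    rw [sub_eq_zero.mp this]

end mollify

section bm
variable {n : ℕ}

theorem bm_abstract (N1 N2 : EuclideanSpace ℝ (Fin n) → ℝ)
    (hc1 : ConvexOn ℝ Set.univ N1) (hc2 : ConvexOn ℝ Set.univ N2)
    (hs1 : ∀ x y, N1 (x + y) ≤ N1 x + N1 y) (hs2 : ∀ x y, N2 (x + y) ≤ N2 x + N2 y)
    (hn2 : ∀ x, N2 (-x) = N2 x) (M : ℝ) (hM : 0 < M)
    (hM1 : ∀ x, N1 x ≤ M * ‖x‖) (hM2 : ∀ x, N2 x ≤ M * ‖x‖) (R : ℝ) (hR : 0 < R)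
    (hd1 : ∀ w, (∀ v, inner ℝ w v ≤ R * N1 v) → N2 w ≤ R)
    (hd2 : ∀ w, (∀ v, inner ℝ w v ≤ R * N2 v) → N1 w ≤ R) :
    1 ≤ ∫⁻ p : EuclideanSpace ℝ (Fin n) × EuclideanSpace ℝ (Fin n),
      ENNReal.ofReal (Real.exp (5 + 2 * R ^ 2 - R * N1 p.1 - R * N2 p.2)) := by
  have hRM : 0 < R * M := by positivity
  obtain ⟨b, hb, ⟨L1, hL1⟩, hbv, hbx, hbm, hb0⟩ := mollify (fun x => R * N1 x)
    (by simpa using hc1.smul hR.le) (fun x y => by nlinarith [hs1 x y]) (R * M) hRM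
    (fun x => by nlinarith [hM1 x]) 1 one_pos
  obtain ⟨a, ha, ⟨L2, hL2⟩, hav, hax, ham, ha0⟩ := mollify (fun x => R * N2 x)
    (by simpa using hc2.smul hR.le) (fun x y => by nlinarith [hs2 x y]) (R * M) hRM
    (fun x => by nlinarith [hM2 x]) 1 one_pos
  have bdd : ∀ (N : EuclideanSpace ℝ (Fin n) → ℝ), (∀ x, N x ≤ M * ‖x‖) → ∀ w : EuclideanSpace ℝ (Fin n),
      (∀ v, inner ℝ w v ≤ R * N v) → ‖w‖ ≤ R * M := by
    intro N hN w hw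
    have h1 := hw w
    rw [real_inner_self_eq_norm_sq] at h1
    have h2 : ‖w‖ ^ 2 ≤ (R * M) * ‖w‖ := by nlinarith [hN w]
    by_contra h
    push Not at h
    nlinarith
  set η := 1 / (1 + (R * M) ^ 2) with hη
  have hη0 : 0 < η := by positivity
  have hη1 : η ≤ 1 := by rw [hη, div_le_one (by positivity)]; nlinarith [sq_nonneg (R * M)]
  have hηρ : η * (R * M) ^ 2 ≤ 1 := by
    rw [hη, div_mul_eq_mul_div, one_mul, div_le_one (by positivity)]; linarith
  have key := contour_bound η hη0 hη1 a b ha hb (max L1 L2) (hL2.weaken (le_max_right _ _))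
    (hL1.weaken (le_max_left _ _)) (R * M) (fun y => bdd N2 hM2 _ (hav y)) (fun x => bdd N1 hM1 _ (hbv x))
  refine key.trans ?_
  set Φ : EuclideanSpace ℝ (Fin n) × EuclideanSpace ℝ (Fin n) → EuclideanSpace ℝ (Fin n) × EuclideanSpace ℝ (Fin n) :=
    fun p => (p.1 + (1:ℝ) • a p.2, p.2 + (-1:ℝ) • b p.1) with hΦ
  have hinj : Function.Injective Φ := by
    intro p p' h
    simp only [hΦ, Prod.mk.injEq, one_smul, neg_smul, ← sub_eq_add_neg] at h
    have e1 : p.1 - p'.1 = -(a p.2 - a p'.2) := by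
      rw [sub_eq_iff_eq_add, ← sub_eq_zero]
      have := sub_eq_zero.mpr h.1
      rw [← this]; abel
    have e2 : p.2 - p'.2 = b p.1 - b p'.1 := by
      rw [sub_eq_iff_eq_add, ← sub_eq_zero]
      have := sub_eq_zero.mpr h.2
      rw [← this]; abel
    have m1 := hbm p.1 p'.1
    have m2 := ham p.2 p'.2
    have m3 : inner ℝ (b p.1 - b p'.1) (p.1 - p'.1) = 0 := by
      apply le_antisymm _ m1
      rw [← e2, e1, inner_neg_right, real_inner_comm]
      linarith
    have m4 := hb0 _ _ m3
    rw [m4, sub_self] at e2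
    have e3 : p.2 = p'.2 := sub_eq_zero.mp e2
    rw [e3, sub_self, neg_zero] at e1
    exact Prod.ext (sub_eq_zero.mp e1) e3
  have haar := haar_prod (n := n)
  have cov := lintegral_image_eq_lintegral_abs_det_fderiv_mul (volume : Measure (EuclideanSpace ℝ (Fin n) × EuclideanSpace ℝ (Fin n)))
    (s := Set.univ) MeasurableSet.univ (fun p _ => (cM_deriv a b ha hb 1 (-1) p).hasFDerivWithinAt)
    hinj.injOn (fun p => ENNReal.ofReal (Real.exp (5 + 2 * R ^ 2 - R * N1 p.1 - R * N2 p.2)))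
  refine le_trans ?_ (setLIntegral_le_lintegral (Φ '' Set.univ) _)
  rw [cov, setLIntegral_univ]
  apply lintegral_mono
  intro p
  have e0 : (-1 : ℝ) • fderiv ℝ b p.1 = - fderiv ℝ b p.1 := by ext1 v; simp
  simp only [e0]
  simp only [one_smul, neg_smul]
  refine mul_le_mul' le_rfl (ENNReal.ofReal_le_ofReal (Real.exp_le_exp.mpr ?_))
  have b1 := hbx p.1
  have b2 := hax p.2
  rw [real_inner_comm] at b1 b2
  have c1 : N1 (a p.2) ≤ R := hd2 _ (hav p.2)
  have c2 : N2 (-b p.1) ≤ R := by rw [hn2]; exact hd1 _ (hbv p.1)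
  have d1 := hs1 p.1 (a p.2)
  have d2 := hs2 p.2 (-b p.1)
  have f1 : R * N1 (p.1 + a p.2) ≤ R * (N1 p.1 + R) := by gcongr; linarith
  have f2 : R * N2 (p.2 + -b p.1) ≤ R * (N2 p.2 + R) := by gcongr; linarith
  linarith

end bm

section polar
variable {n : ℕ}

/-- the polar set -/
def pol (K : Set (EuclideanSpace ℝ (Fin n))) : Set (EuclideanSpace ℝ (Fin n)) :=
  {y | ∀ x ∈ K, inner ℝ x y ≤ 1}

theorem pol_convex (K : Set (EuclideanSpace ℝ (Fin n))) : Convex ℝ (pol K) := by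
  intro y hy y' hy' s t hs ht hst x hx
  rw [inner_add_right, real_inner_smul_right, real_inner_smul_right]
  have := hy x hx
  have := hy' x hx
  nlinarith

theorem pol_closed (K : Set (EuclideanSpace ℝ (Fin n))) : IsClosed (pol K) := by
  have : pol K = ⋂ x ∈ K, {y | inner ℝ x y ≤ 1} := by ext; simp [pol]
  rw [this]
  exact isClosed_biInter fun x _ => isClosed_le (by fun_prop) continuous_const

theorem pol_zero (K : Set (EuclideanSpace ℝ (Fin n))) : 0 ∈ pol K := fun x _ => by simp

theorem pol_bdd (K : Set (EuclideanSpace ℝ (Fin n))) (h : K ∈ nhds 0) : Bornology.IsBounded (pol K) := by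
  obtain ⟨r, hr, hrK⟩ := Metric.nhds_basis_closedBall.mem_iff.mp h
  rw [isBounded_iff_forall_norm_le]
  refine ⟨1 / r, fun y hy => ?_⟩
  by_cases h0 : y = 0
  · rw [h0, norm_zero]; positivity
  have hy0 : 0 < ‖y‖ := norm_pos_iff.mpr h0
  have := hy ((r / ‖y‖) • y) (hrK (by simp [norm_smul, hr.le, abs_of_pos hr, hy0.ne']))
  rw [real_inner_smul_left, real_inner_self_eq_norm_sq] at this
  rw [le_div_iff₀ hr]
  have e : r / ‖y‖ * ‖y‖ ^ 2 = ‖y‖ * r := by field_simp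
  linarith

theorem pol_nhds (K : Set (EuclideanSpace ℝ (Fin n))) (h : Bornology.IsBounded K) : pol K ∈ nhds 0 := by
  obtain ⟨M, hM⟩ := isBounded_iff_forall_norm_le.mp h
  have hpos : 0 < 1 / (|M| + 1) := by positivity
  filter_upwards [Metric.closedBall_mem_nhds 0 hpos] with y hy x hx
  have h1 : ‖y‖ ≤ 1 / (|M| + 1) := by simpa using hy
  have h2 : ‖x‖ ≤ |M| + 1 := (hM x hx).trans ((le_abs_self M).trans (by linarith))
  calc inner ℝ x y ≤ ‖x‖ * ‖y‖ := real_inner_le_norm _ _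
    _ ≤ (|M| + 1) * (1 / (|M| + 1)) := by gcongr
    _ = 1 := by field_simp

theorem pol_compact (K : Set (EuclideanSpace ℝ (Fin n))) (h : K ∈ nhds 0) : IsCompact (pol K) :=
  Metric.isCompact_of_isClosed_isBounded (pol_closed K) (pol_bdd K h)

theorem pol_neg (K : Set (EuclideanSpace ℝ (Fin n))) (hs : ∀ x ∈ K, -x ∈ K) : ∀ y ∈ pol K, -y ∈ pol K := by
  intro y hy x hx
  have := hy (-x) (hs x hx)
  rwa [inner_neg_left, ← inner_neg_right] at this

/-- separation form of the bipolar theorem -/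
theorem exists_pol_sep (K : Set (EuclideanSpace ℝ (Fin n))) (hc : Convex ℝ K) (hcl : IsClosed K) (h0 : (0 : EuclideanSpace ℝ (Fin n)) ∈ K)
    (x : EuclideanSpace ℝ (Fin n)) (hx : x ∉ K) : ∃ y ∈ pol K, 1 < inner ℝ x y := by
  obtain ⟨f, u, hf, hu⟩ := geometric_hahn_banach_closed_point hc hcl hx
  have hu0 : 0 < u := by simpa using hf 0 h0
  set w := (InnerProductSpace.toDual ℝ (EuclideanSpace ℝ (Fin n))).symm f with hw
  have hwf : ∀ v, inner ℝ v w = f v := fun v => by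
    rw [real_inner_comm]; exact InnerProductSpace.toDual_symm_apply
  refine ⟨(1 / u) • w, fun v hv => ?_, ?_⟩
  · rw [real_inner_smul_right, hwf, one_div_mul_eq_div, div_le_one hu0]
    exact (hf v hv).le
  · rw [real_inner_smul_right, hwf, one_div_mul_eq_div, lt_div_iff₀ hu0]
    linarith

theorem bipolar (K : Set (EuclideanSpace ℝ (Fin n))) (hc : Convex ℝ K) (hcl : IsClosed K) (h0 : (0 : EuclideanSpace ℝ (Fin n)) ∈ K)
    (x : EuclideanSpace ℝ (Fin n)) (hx : ∀ y ∈ pol K, inner ℝ x y ≤ 1) : x ∈ K := by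
  by_contra h
  obtain ⟨y, hy, hy1⟩ := exists_pol_sep K hc hcl h0 x h
  linarith [hx y hy]

theorem exp_gauge_int (U : Set (EuclideanSpace ℝ (Fin n))) (hc : Convex ℝ U) (hnh : U ∈ nhds 0)
    (hb : Bornology.IsBounded U) (hs : ∀ x ∈ U, -x ∈ U) (R : ℝ) (hR : 0 < R) :
    ∫⁻ x, ENNReal.ofReal (Real.exp (-(R * gauge U x))) ≤
      ENNReal.ofReal (n.factorial / R ^ n) * volume U := by
  have habs : Absorbent ℝ U := absorbent_nhds_zero hnh
  have h0 : (0 : EuclideanSpace ℝ (Fin n)) ∈ U := mem_of_mem_nhds hnh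
  have hsm : ∀ (r : ℝ) x, gauge U (r • x) = |r| * gauge U x := by
    intro r x
    rcases le_or_gt 0 r with h | h
    · rw [gauge_smul_of_nonneg h, abs_of_nonneg h, smul_eq_mul]
    · rw [abs_of_neg h, ← smul_eq_mul, ← gauge_smul_of_nonneg (by linarith), neg_smul, gauge_neg hs]
  have key := measure_lt_one_eq_integral_div_gamma (volume : Measure (EuclideanSpace ℝ (Fin n)))
    (g := fun x => R * gauge U x) (by simp) (fun x => by rw [gauge_neg hs])
    (fun x y => by rw [← mul_add]; gcongr; exact gauge_add_le hc habs x y)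
    (fun {x} hx => by
      have : gauge U x = 0 := by simpa [hR.ne'] using hx
      exact (gauge_eq_zero habs ((NormedSpace.isVonNBounded_iff ℝ).mpr hb)).mp this)
    (fun r x => by rw [hsm]; apply le_of_eq; ring) (p := 1) one_pos
  simp only [Real.rpow_one, div_one, finrank_euclideanSpace_fin, Real.Gamma_nat_eq_factorial] at key
  have hopen : IsOpen {x : EuclideanSpace ℝ (Fin n) | R * gauge U x < 1} :=
    isOpen_lt ((continuous_gauge hc hnh).const_mul R |>.congr fun _ => rfl) continuous_const
  have hpos : 0 < volume {x : EuclideanSpace ℝ (Fin n) | R * gauge U x < 1} :=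
    hopen.measure_pos _ ⟨0, by simp⟩
  have hIpos : 0 < ∫ x, Real.exp (-(R * gauge U x)) := by
    by_contra h
    have : (∫ x, Real.exp (-(R * gauge U x))) / (n.factorial : ℝ) ≤ 0 :=
      div_nonpos_of_nonpos_of_nonneg (not_lt.mp h) (by positivity)
    rw [key, ENNReal.ofReal_of_nonpos this] at hpos
    exact lt_irrefl _ hpos
  have hintg : Integrable (fun x => Real.exp (-(R * gauge U x))) := by
    by_contra h
    rw [integral_undef h] at hIpos
    exact lt_irrefl _ hIpos
  have hsub : volume {x : EuclideanSpace ℝ (Fin n) | R * gauge U x < 1} ≤ ENNReal.ofReal ((1 / R) ^ n) * volume U := by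
    have : {x : EuclideanSpace ℝ (Fin n) | R * gauge U x < 1} ⊆ (1 / R) • U := by
      intro x hx
      rw [Set.mem_smul_set_iff_inv_smul_mem₀ (by positivity)]
      apply setOfPred_gauge_lt_one_subset_self hc h0 habs
      change gauge U _ < 1
      rw [hsm, abs_of_pos (by positivity)]
      simpa using hx
    refine (measure_mono this).trans ?_
    rw [Measure.addHaar_smul, finrank_euclideanSpace_fin, abs_of_pos (by positivity)]
  rw [← ofReal_integral_eq_lintegral_ofReal hintg (Filter.Eventually.of_forall fun x => (Real.exp_pos _).le)]
  have hfac : (0:ℝ) < n.factorial := by positivity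
  have e1 : ENNReal.ofReal (∫ x, Real.exp (-(R * gauge U x))) = ENNReal.ofReal n.factorial *
      volume {x : EuclideanSpace ℝ (Fin n) | R * gauge U x < 1} := by
    rw [key, ← ENNReal.ofReal_mul hfac.le]
    congr 1; field_simp
  rw [e1]
  calc _ ≤ ENNReal.ofReal n.factorial * (ENNReal.ofReal ((1 / R) ^ n) * volume U) := by gcongr
    _ = _ := by rw [← mul_assoc, ← ENNReal.ofReal_mul hfac.le, one_div, inv_pow, div_eq_mul_inv]

theorem bm_sym (hn : 1 ≤ n) (U : Set (EuclideanSpace ℝ (Fin n))) (hc : Convex ℝ U) (hcl : IsClosed U) (hnh : U ∈ nhds 0)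
    (hb : Bornology.IsBounded U) (hs : ∀ x ∈ U, -x ∈ U) :
    ENNReal.ofReal (Real.exp (-7) ^ n / n.factorial) ≤ volume U * volume (pol U) := by
  have h0 : (0 : EuclideanSpace ℝ (Fin n)) ∈ U := mem_of_mem_nhds hnh
  have hcvx : ∀ V : Set (EuclideanSpace ℝ (Fin n)), Convex ℝ V → V ∈ nhds 0 → ConvexOn ℝ Set.univ (gauge V) := by
    intro V hV hV0
    refine ⟨convex_univ, fun x _ y _ s t hs ht hst => ?_⟩
    refine (gauge_add_le hV (absorbent_nhds_zero hV0) _ _).trans ?_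
    rw [gauge_smul_of_nonneg hs, gauge_smul_of_nonneg ht]
  have hbd : ∀ V : Set (EuclideanSpace ℝ (Fin n)), V ∈ nhds 0 → ∃ M, 0 < M ∧ ∀ x, gauge V x ≤ M * ‖x‖ := by
    intro V hV
    obtain ⟨r, hr, hrV⟩ := Metric.mem_nhds_iff.mp hV
    refine ⟨1 / r, by positivity, fun x => ?_⟩
    have := mul_gauge_le_norm (x := x) hrV
    rw [one_div_mul_eq_div, le_div_iff₀ hr]; linarith
  have hnp := pol_nhds U hb
  have hcp := pol_convex U
  obtain ⟨M1, hM1, hM1'⟩ := hbd U hnh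
  obtain ⟨M2, hM2, hM2'⟩ := hbd _ hnp
  set R := Real.sqrt n with hR
  have hn0 : (0:ℝ) < n := by exact_mod_cast hn
  have hR0 : 0 < R := Real.sqrt_pos.mpr hn0
  have hR2 : R ^ 2 = n := Real.sq_sqrt hn0.le
  have key := bm_abstract (gauge U) (gauge (pol U)) (hcvx U hc hnh) (hcvx _ hcp hnp)
    (gauge_add_le hc (absorbent_nhds_zero hnh)) (gauge_add_le hcp (absorbent_nhds_zero hnp))
    (gauge_neg (pol_neg U hs)) (max M1 M2) (by positivity)
    (fun x => (hM1' x).trans (by gcongr; exact le_max_left _ _))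
    (fun x => (hM2' x).trans (by gcongr; exact le_max_right _ _)) R hR0 ?_ ?_
  · have e1 : ∫⁻ p : EuclideanSpace ℝ (Fin n) × EuclideanSpace ℝ (Fin n),
        ENNReal.ofReal (Real.exp (5 + 2 * R ^ 2 - R * gauge U p.1 - R * gauge (pol U) p.2)) =
        ENNReal.ofReal (Real.exp (5 + 2 * R ^ 2)) * ((∫⁻ x, ENNReal.ofReal (Real.exp (-(R * gauge U x)))) *
        (∫⁻ y, ENNReal.ofReal (Real.exp (-(R * gauge (pol U) y))))) := by
      have m1 : Measurable (fun x => ENNReal.ofReal (Real.exp (-(R * gauge U x)))) := by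
        have := (continuous_gauge hc hnh).measurable
        fun_prop
      have m2 : Measurable (fun x => ENNReal.ofReal (Real.exp (-(R * gauge (pol U) x)))) := by
        have := (continuous_gauge hcp hnp).measurable
        fun_prop
      rw [← lintegral_prod_mul m1.aemeasurable m2.aemeasurable, ← lintegral_const_mul' _ _ ENNReal.ofReal_ne_top]
      apply lintegral_congr
      intro p
      rw [← ENNReal.ofReal_mul (Real.exp_pos _).le, ← ENNReal.ofReal_mul (Real.exp_pos _).le, ← Real.exp_add, ← Real.exp_add]
      congr 2; ring
    rw [e1] at key
    have i1 := exp_gauge_int U hc hnh hb hs R hR0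
    have i2 := exp_gauge_int (pol U) hcp hnp (pol_bdd U hnh) (pol_neg U hs) R hR0
    have h3 : 1 ≤ ENNReal.ofReal (Real.exp (5 + 2 * R ^ 2) * (n.factorial / R ^ n * (n.factorial / R ^ n))) * (volume U * volume (pol U)) := by
      refine key.trans ?_
      calc _ ≤ ENNReal.ofReal (Real.exp (5 + 2 * R ^ 2)) * ((ENNReal.ofReal (n.factorial / R ^ n) * volume U) *
          (ENNReal.ofReal (n.factorial / R ^ n) * volume (pol U))) := by gcongr
        _ = _ := by
          rw [ENNReal.ofReal_mul (by positivity), ENNReal.ofReal_mul (by positivity)]; ring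
    have h4 : Real.exp (5 + 2 * R ^ 2) * (n.factorial / R ^ n * (n.factorial / R ^ n)) ≤ Real.exp 7 ^ n * n.factorial := by
      have e2 : (n.factorial / R ^ n * (n.factorial / R ^ n) : ℝ) = n.factorial * (n.factorial / (n:ℝ) ^ n) := by
        rw [← hR2, ← pow_mul, mul_comm 2 n, pow_mul]; field_simp
      have e3 : (n.factorial / (n:ℝ) ^ n : ℝ) ≤ 1 := by
        rw [div_le_one (by positivity)]
        exact_mod_cast Nat.factorial_le_pow n
      rw [e2, ← Real.exp_nat_mul]
      have e4 : (1:ℝ) ≤ n := by exact_mod_cast hn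
      calc _ ≤ Real.exp (n * 7) * (n.factorial * 1) := by
            gcongr; rw [hR2]; linarith
        _ = _ := by ring
    have h5 : 1 ≤ ENNReal.ofReal (Real.exp 7 ^ n * n.factorial) * (volume U * volume (pol U)) :=
      h3.trans (by gcongr)
    have h6 : (0:ℝ) < Real.exp 7 ^ n * n.factorial := by positivity
    have h7 : (Real.exp (-7) ^ n / n.factorial : ℝ) = (Real.exp 7 ^ n * n.factorial)⁻¹ := by
      rw [Real.exp_neg, inv_pow]; field_simp
    rw [h7, ENNReal.ofReal_inv_of_pos h6]
    rw [ENNReal.inv_le_iff_le_mul]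
    · exact h5
    · intro _; exact (ENNReal.ofReal_pos.mpr h6).ne'
    · intro _ h; rw [h] at h5; simp at h5
  · intro w hw
    apply gauge_le_of_mem hR0.le
    rw [Set.mem_smul_set_iff_inv_smul_mem₀ hR0.ne']
    intro v hv
    rw [real_inner_smul_right, real_inner_comm]
    have h1 := hw v
    have h2 := gauge_le_one_of_mem hv
    rw [inv_mul_le_iff₀ hR0]
    nlinarith
  · intro w hw
    apply gauge_le_of_mem hR0.le
    rw [Set.mem_smul_set_iff_inv_smul_mem₀ hR0.ne']
    apply bipolar U hc hcl h0
    intro v hv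
    rw [real_inner_smul_left]
    have h1 := hw v
    have h2 := gauge_le_one_of_mem hv
    rw [inv_mul_le_iff₀ hR0]
    nlinarith

end polar

section rs
variable {n : ℕ}

theorem vol_smul (c : ℝ) (hc : 0 ≤ c) (A : Set (EuclideanSpace ℝ (Fin n))) :
    volume (c • A) = ENNReal.ofReal (c ^ n) * volume A := by
  rw [Measure.addHaar_smul, finrank_euclideanSpace_fin, abs_of_nonneg (by positivity)]

theorem rogers_shephard (L : Set (EuclideanSpace ℝ (Fin n))) (hL : IsCompact L) (hc : Convex ℝ L)
    (h0 : volume L ≠ 0) : volume (L - L) ≤ ENNReal.ofReal (4 ^ n) * volume L := by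
  have hm : MeasurableSet L := hL.measurableSet
  have htop : volume L ≠ ⊤ := hL.measure_lt_top.ne
  set D := (1/2 : ℝ) • (L - L) with hD
  have hLL : IsCompact (L - L) := by
    rw [sub_eq_add_neg]; exact hL.add hL.neg
  have hDm : MeasurableSet D := (hLL.smul (1/2:ℝ)).measurableSet
  have hmeas : Measurable (fun q : EuclideanSpace ℝ (Fin n) × EuclideanSpace ℝ (Fin n) =>
      L.indicator (1 : EuclideanSpace ℝ (Fin n) → ENNReal) q.2 * L.indicator (1 : EuclideanSpace ℝ (Fin n) → ENNReal) (q.2 - q.1)) := by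
    have : Measurable (L.indicator (1 : EuclideanSpace ℝ (Fin n) → ENNReal)) := measurable_one.indicator hm
    exact (this.comp measurable_snd).mul (this.comp (measurable_snd.sub measurable_fst))
  have hmeas' : Measurable (fun q : EuclideanSpace ℝ (Fin n) =>
      L.indicator (1 : EuclideanSpace ℝ (Fin n) → ENNReal) q) := measurable_one.indicator hm
  have e1 : ∫⁻ x, ∫⁻ z, L.indicator (1 : EuclideanSpace ℝ (Fin n) → ENNReal) z * L.indicator (1 : EuclideanSpace ℝ (Fin n) → ENNReal) (z - x)
      = volume L * volume L := by
    rw [lintegral_lintegral_swap hmeas.aemeasurable]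
    have : ∀ z, ∫⁻ x, L.indicator (1 : EuclideanSpace ℝ (Fin n) → ENNReal) z * L.indicator (1 : EuclideanSpace ℝ (Fin n) → ENNReal) (z - x) = L.indicator (1 : EuclideanSpace ℝ (Fin n) → ENNReal) z * volume L := by
      intro z
      have hh : Measurable (fun x => L.indicator (1 : EuclideanSpace ℝ (Fin n) → ENNReal) (z - x)) :=
        hmeas'.comp (measurable_const.sub measurable_id)
      rw [lintegral_const_mul _ hh,
        lintegral_sub_left_eq_self (fun x => L.indicator (1 : EuclideanSpace ℝ (Fin n) → ENNReal) x) z, lintegral_indicator_one hm]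
    simp_rw [this]
    rw [lintegral_mul_const _ hmeas', lintegral_indicator_one hm]
  have e2 : ∀ x ∈ D, ENNReal.ofReal ((1/2)^n) * volume L ≤ ∫⁻ z, L.indicator (1 : EuclideanSpace ℝ (Fin n) → ENNReal) z * L.indicator (1 : EuclideanSpace ℝ (Fin n) → ENNReal) (z - x) := by
    intro x hx
    obtain ⟨_, ⟨a, ha, b, hb, rfl⟩, rfl⟩ := hx
    have hsub : ((1/2:ℝ) • a) +ᵥ ((1/2 : ℝ) • L) ⊆ {z | z ∈ L ∧ z - (1/2:ℝ) • (a - b) ∈ L} := by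
      rintro _ ⟨_, ⟨w, hw, rfl⟩, rfl⟩
      constructor
      · exact hc ha hw (by norm_num) (by norm_num) (by norm_num)
      · have := hc hb hw (a := 1/2) (b := 1/2) (by norm_num) (by norm_num) (by norm_num)
        convert this using 1
        simp only [vadd_eq_add, smul_sub]; abel
    calc ENNReal.ofReal ((1/2)^n) * volume L = volume (((1/2:ℝ) • a) +ᵥ ((1/2 : ℝ) • L)) := by
          rw [measure_vadd, vol_smul _ (by norm_num)]
      _ ≤ volume {z | z ∈ L ∧ z - (1/2:ℝ) • (a - b) ∈ L} := measure_mono hsub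
      _ ≤ _ := by
        have hm2 : MeasurableSet {z | z ∈ L ∧ z - (1/2:ℝ) • (a - b) ∈ L} :=
          hm.inter (measurable_sub_const _ hm)
        rw [← lintegral_indicator_one hm2]
        apply lintegral_mono
        intro z
        by_cases hz : z ∈ {z | z ∈ L ∧ z - (1/2:ℝ) • (a - b) ∈ L}
        · rw [Set.indicator_of_mem hz]
          simp only
          rw [Set.indicator_of_mem hz.1, Set.indicator_of_mem hz.2]; simp
        · rw [Set.indicator_of_notMem hz]; simp
  have e3 : (ENNReal.ofReal ((1/2)^n) * volume L) * volume D ≤ volume L * volume L := by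
    rw [← e1, ← setLIntegral_const]
    refine (setLIntegral_mono' hDm e2).trans (setLIntegral_le_lintegral _ _)
  rw [hD, vol_smul _ (by norm_num)] at e3
  have e4 : (ENNReal.ofReal ((1/2)^n) * ENNReal.ofReal ((1/2)^n)) * volume (L - L) ≤ volume L := by
    have : volume L * ((ENNReal.ofReal ((1/2)^n) * ENNReal.ofReal ((1/2)^n)) * volume (L - L)) ≤ volume L * volume L := by
      refine le_trans (le_of_eq ?_) e3; ring
    exact (ENNReal.mul_le_mul_iff_right h0 htop).mp this
  rw [← ENNReal.ofReal_mul (by positivity), ← mul_pow] at e4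
  calc volume (L - L) = ENNReal.ofReal (4 ^ n) * (ENNReal.ofReal ((1/2 * (1/2))^n) * volume (L - L)) := by
        rw [← mul_assoc, ← ENNReal.ofReal_mul (by positivity), ← mul_pow]; norm_num
    _ ≤ _ := by gcongr

end rs

section oned

theorem exists_median (μ : Measure ℝ) [IsFiniteMeasure μ] [NullSingletonClass μ] (h0 : μ ≠ 0) :
    ∃ t : ℝ, μ (Set.Iic t) = μ Set.univ / 2 ∧ μ (Set.Ioi t) = μ Set.univ / 2 := by
  have hpos : 0 < μ.real Set.univ := by
    rw [measureReal_def]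
    exact ENNReal.toReal_pos (by simpa using h0) (measure_ne_top _ _)
  have hcont : Continuous fun t : ℝ => μ.real (Set.Iic t) := by
    have hi : Integrable (fun _ : ℝ => (1:ℝ)) μ := integrable_const _
    have h2 : ∀ t, μ.real (Set.Iic t) = (∫ x in Set.Iic 0, (1:ℝ) ∂μ) + ∫ x in (0:ℝ)..t, (1:ℝ) ∂μ := by
      intro t
      rw [← intervalIntegral.integral_Iic_sub_Iic hi.integrableOn hi.integrableOn]
      simp
    simp_rw [h2]
    exact continuous_const.add (hi.continuous_primitive 0)
  have htop : Filter.Tendsto (fun t : ℝ => μ.real (Set.Iic t)) Filter.atTop (nhds (μ.real Set.univ)) := by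
    exact (ENNReal.tendsto_toReal (measure_ne_top _ _)).comp (tendsto_measure_Iic_atTop μ)
  have hbot : Filter.Tendsto (fun t : ℝ => μ.real (Set.Iic t)) Filter.atBot (nhds 0) := by
    have h3 := (ENNReal.tendsto_toReal (measure_ne_top _ _)).comp (tendsto_measure_Ici_atBot μ)
    have h4 : ∀ t, μ.real (Set.Iic t) = μ.real Set.univ - (μ (Set.Ici t)).toReal := by
      intro t
      rw [← Set.compl_Ioi, measureReal_compl measurableSet_Ioi, measureReal_congr Ioi_ae_eq_Ici]
      rfl
    simp_rw [h4]
    have h5 := (tendsto_const_nhds (x := μ.real Set.univ)).sub h3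
    rw [← measureReal_def, sub_self] at h5
    exact h5
  have h1 : ∃ a, μ.real (Set.Iic a) ≤ μ.real Set.univ / 2 :=
    ((hbot.eventually_le_const (by positivity : (0:ℝ) < μ.real Set.univ / 2))).exists
  have h2 : ∃ a, μ.real Set.univ / 2 ≤ μ.real (Set.Iic a) :=
    ((htop.eventually_const_le (by linarith : μ.real Set.univ / 2 < μ.real Set.univ))).exists
  obtain ⟨t, ht⟩ := mem_range_of_exists_le_of_exists_ge hcont h1 h2
  have h3 : μ (Set.Iic t) = μ Set.univ / 2 := by
    rw [← ENNReal.toReal_eq_toReal_iff' (measure_ne_top _ _) (by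
      exact ENNReal.div_ne_top (measure_ne_top _ _) (by norm_num))]
    simpa [measureReal_def] using ht
  refine ⟨t, h3, ?_⟩
  rw [← Set.compl_Iic, measure_compl measurableSet_Iic (measure_ne_top _ _), h3]
  exact ENNReal.sub_half (measure_ne_top _ _)

theorem lint_prod_le {α β : Type*} [MeasurableSpace α] [MeasurableSpace β] (μ : Measure α) (ν : Measure β)
    (φ p : α → ENNReal) (ψ q : β → ENNReal) (hφ : Measurable φ) (hψ : Measurable ψ)
    (hp : Measurable p) (hq : Measurable q) (c : ENNReal) (S : Set α) (T : Set β)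
    (hS : MeasurableSet S) (hT : MeasurableSet T)
    (h : ∀ s ∈ S, ∀ t ∈ T, φ s * ψ t ≤ c * (p s * q t)) :
    (∫⁻ s in S, φ s ∂μ) * (∫⁻ t in T, ψ t ∂ν) ≤ c * ((∫⁻ s in S, p s ∂μ) * (∫⁻ t in T, q t ∂ν)) := by
  rw [← lintegral_mul_const _ hφ, ← lintegral_mul_const _ hp, ← lintegral_const_mul _ (hp.mul_const _)]
  refine setLIntegral_mono' hS ?_
  intro s hs
  rw [← lintegral_const_mul _ hψ, ← lintegral_const_mul _ hq, ← lintegral_const_mul _ (hq.const_mul _)]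
  exact setLIntegral_mono' hT (fun t ht => h s hs t ht)

theorem lint_exp (a c : ℝ) (ha : 0 < a) :
    ∫⁻ x in Set.Ioi c, ENNReal.ofReal (Real.exp (-a * x)) = ENNReal.ofReal (Real.exp (-a * c) / a) := by
  rw [← ofReal_integral_eq_lintegral_ofReal (integrableOn_exp_mul_Ioi (by linarith) c)
    (Filter.Eventually.of_forall fun _ => (Real.exp_pos _).le), integral_exp_mul_Ioi (by linarith)]
  congr 1
  rw [neg_div_neg_eq]

theorem oned (φ ψ : ℝ → ENNReal) (hφ : Measurable φ) (hψ : Measurable ψ) (c : ENNReal)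
    (hfin : ∫⁻ s in Set.Ioi 0, φ s ≠ ⊤)
    (h : ∀ s > 0, ∀ t > 0, φ s * ψ t ≤ c * ENNReal.ofReal (Real.exp (-(s * t)))) :
    (∫⁻ s in Set.Ioi 0, φ s) * (∫⁻ t in Set.Ioi 0, ψ t) ≤ 4 * c := by
  set a := ∫⁻ s in Set.Ioi 0, φ s with ha
  by_cases ha0 : a = 0
  · rw [ha0]; simp
  set μ : Measure ℝ := (volume.restrict (Set.Ioi 0)).withDensity φ with hμ
  have hμu : μ Set.univ = a := by rw [hμ, withDensity_apply _ MeasurableSet.univ]; simp [ha]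
  have : IsFiniteMeasure μ := ⟨by rw [hμu]; exact hfin.lt_top⟩
  obtain ⟨s0, hs1, hs2⟩ := exists_median μ (by
    intro h; rw [h] at hμu; exact ha0 (by rw [← hμu]; simp))
  rw [hμu] at hs1 hs2
  have hs0 : 0 < s0 := by
    by_contra hcon
    push Not at hcon
    rw [hμ, withDensity_apply _ measurableSet_Iic, Measure.restrict_restrict measurableSet_Iic] at hs1
    have : Set.Iic s0 ∩ Set.Ioi 0 = ∅ := by
      ext x; simp; intro hx; linarith
    rw [this] at hs1
    simp at hs1
    rw [eq_comm, ENNReal.div_eq_zero_iff] at hs1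
    rcases hs1 with h | h
    · exact ha0 h
    · norm_num at h
  rw [hμ, withDensity_apply _ measurableSet_Iic, Measure.restrict_restrict measurableSet_Iic] at hs1
  rw [hμ, withDensity_apply _ measurableSet_Ioi, Measure.restrict_restrict measurableSet_Ioi] at hs2
  rw [Set.Iic_inter_Ioi] at hs1
  rw [Set.Ioi_inter_Ioi, sup_of_le_left hs0.le] at hs2
  have hsplit : ∫⁻ t in Set.Ioi 0, ψ t = (∫⁻ t in Set.Ioc 0 (1/s0), ψ t) + ∫⁻ t in Set.Ioi (1/s0), ψ t := by
    rw [← lintegral_union measurableSet_Ioi (Set.Ioc_disjoint_Ioi le_rfl), Set.Ioc_union_Ioi_eq_Ioi (by positivity)]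
  have hA : a / 2 * (∫⁻ t in Set.Ioc 0 (1/s0), ψ t) ≤ c := by
    rw [← hs1]
    refine (lint_prod_le volume volume φ (fun _ => 1) ψ (fun _ => 1) hφ hψ measurable_const measurable_const c
      _ _ measurableSet_Ioc measurableSet_Ioc ?_).trans ?_
    · intro s hs t ht
      refine (h s hs.1 t ht.1).trans ?_
      gcongr
      rw [mul_one]
      exact ENNReal.ofReal_le_one.mpr (Real.exp_le_one_iff.mpr (by nlinarith [mul_pos hs.1 ht.1]))
    · simp only [lintegral_const, Measure.restrict_apply_univ, Real.volume_Ioc, one_mul, sub_zero]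
      rw [← ENNReal.ofReal_mul hs0.le, mul_one_div_cancel hs0.ne']
      simp
  have hB : a / 2 * (∫⁻ t in Set.Ioi (1/s0), ψ t) ≤ c := by
    rw [← hs2]
    refine (lint_prod_le volume volume φ (fun s => ENNReal.ofReal (Real.exp (-(1/s0) * s))) ψ
      (fun t => ENNReal.ofReal (Real.exp (-s0 * t))) hφ hψ (by fun_prop) (by fun_prop)
      (c * ENNReal.ofReal (Real.exp 1))
      _ _ measurableSet_Ioi measurableSet_Ioi ?_).trans ?_
    · intro s hs t ht
      rw [Set.mem_Ioi] at hs ht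
      have ht0 : 0 < t := lt_trans (by positivity) ht
      refine (h s (hs0.trans hs) t ht0).trans ?_
      rw [mul_assoc]
      gcongr
      rw [← ENNReal.ofReal_mul (Real.exp_pos _).le, ← ENNReal.ofReal_mul (Real.exp_pos _).le, ← Real.exp_add, ← Real.exp_add]
      apply ENNReal.ofReal_le_ofReal
      apply Real.exp_le_exp.mpr
      have h1 : 0 < s / s0 - 1 := by rw [sub_pos, lt_div_iff₀ hs0]; linarith
      have h2 : 0 < t * s0 - 1 := by rw [div_lt_iff₀ hs0] at ht; linarith
      have h3 := mul_pos h1 h2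
      have h4 : (s / s0 - 1) * (t * s0 - 1) = s * t - s / s0 - t * s0 + 1 := by field_simp; ring
      have h5 : -(1 / s0) * s = - (s / s0) := by ring
      rw [h5]; nlinarith
    · rw [lint_exp _ _ (by positivity), lint_exp _ _ hs0, ← ENNReal.ofReal_mul (by positivity), mul_assoc,
        ← ENNReal.ofReal_mul (by positivity)]
      have : Real.exp 1 * (Real.exp (-(1 / s0) * s0) / (1 / s0) * (Real.exp (-s0 * (1 / s0)) / s0)) ≤ 1 := by
        have e1 : -(1 / s0) * s0 = -1 := by field_simp
        have e2 : -s0 * (1/s0) = -1 := by field_simp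
        rw [e1, e2]
        have e3 : Real.exp (-1) * Real.exp 1 = 1 := by rw [← Real.exp_add]; simp
        have : Real.exp 1 * (Real.exp (-1) / (1 / s0) * (Real.exp (-1) / s0)) = (Real.exp (-1) * Real.exp 1) * Real.exp (-1) := by
          field_simp
        rw [this, e3, one_mul]
        exact Real.exp_le_one_iff.mpr (by norm_num)
      calc _ ≤ c * ENNReal.ofReal 1 := by gcongr
        _ = c := by simp
  calc a * (∫⁻ t in Set.Ioi 0, ψ t) = 2 * (a / 2 * (∫⁻ t in Set.Ioc 0 (1/s0), ψ t) + a / 2 * (∫⁻ t in Set.Ioi (1/s0), ψ t)) := by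
        rw [hsplit, ← mul_add, ← mul_assoc, ENNReal.mul_div_cancel (by norm_num) (by norm_num)]
    _ ≤ 2 * (c + c) := by gcongr
    _ = 4 * c := by ring

end oned

section nice

/-- bounded measurable nonnegative functions with bounded support -/
structure Nice {V : Type*} [NormedAddCommGroup V] [MeasurableSpace V] (h : V → ℝ) : Prop where
  meas : Measurable h
  nonneg : ∀ x, 0 ≤ h x
  bdd : ∃ M, ∀ x, h x ≤ M
  supp : ∃ R, ∀ x, h x ≠ 0 → ‖x‖ ≤ R

theorem Nice.integrable_mul {V : Type*} [NormedAddCommGroup V] [MeasureSpace V] [BorelSpace V]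
    [ProperSpace V] [IsFiniteMeasureOnCompacts (volume : Measure V)]
    {h : V → ℝ} (hh : Nice h) (p : V → ℝ) (hp : Continuous p) :
    Integrable (fun x => p x * h x) := by
  obtain ⟨M, hM⟩ := hh.bdd
  obtain ⟨R, hR⟩ := hh.supp
  obtain ⟨P, hP⟩ := (isCompact_closedBall (0:V) R).exists_bound_of_continuousOn hp.continuousOn
  have hi : Integrable ((Metric.closedBall (0:V) R).indicator (fun _ => P * M)) := by
    rw [integrable_indicator_iff Metric.isClosed_closedBall.measurableSet]
    exact integrableOn_const (isCompact_closedBall (0:V) R).measure_lt_top.ne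
  refine hi.mono' (hp.measurable.mul hh.meas).aestronglyMeasurable (Filter.Eventually.of_forall fun x => ?_)
  by_cases hx : h x = 0
  · rw [hx, mul_zero, norm_zero]
    apply Set.indicator_nonneg
    intro y hy
    exact mul_nonneg ((norm_nonneg _).trans (hP y hy)) ((hh.nonneg y).trans (hM y))
  · have hmem : x ∈ Metric.closedBall (0:V) R := by simpa using hR x hx
    rw [Set.indicator_of_mem hmem, norm_mul, Real.norm_of_nonneg (hh.nonneg x)]
    exact mul_le_mul (hP x hmem) (hM x) (hh.nonneg x) ((norm_nonneg _).trans (hP x hmem))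

theorem Nice.integrable {V : Type*} [NormedAddCommGroup V] [MeasureSpace V] [BorelSpace V]
    [ProperSpace V] [IsFiniteMeasureOnCompacts (volume : Measure V)]
    {h : V → ℝ} (hh : Nice h) : Integrable h := by
  simpa using hh.integrable_mul (fun _ => 1) continuous_const

theorem Nice.indicator {V : Type*} [NormedAddCommGroup V] [MeasurableSpace V]
    {h : V → ℝ} (hh : Nice h) (S : Set V) (hS : MeasurableSet S) : Nice (S.indicator h) := by
  obtain ⟨M, hM⟩ := hh.bdd
  obtain ⟨R, hR⟩ := hh.supp
  refine ⟨hh.meas.indicator hS, fun x => Set.indicator_nonneg (fun y _ => hh.nonneg y) x, ⟨M, fun x => ?_⟩,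
    ⟨R, fun x hx => hR x ?_⟩⟩
  · exact (Set.indicator_le_self' (fun _ _ => hh.nonneg _) x).trans (hM x)
  · intro h0; apply hx; by_cases hxS : x ∈ S <;> simp [hxS, h0]

variable {n : ℕ}

theorem Nice.slice {h : ℝ × (Fin n → ℝ) → ℝ} (hh : Nice h) (x : Fin n → ℝ) : Nice (fun s => h (s, x)) := by
  obtain ⟨M, hM⟩ := hh.bdd
  obtain ⟨R, hR⟩ := hh.supp
  exact ⟨hh.meas.comp (by fun_prop), fun s => hh.nonneg _, ⟨M, fun s => hM _⟩,
    ⟨R, fun s hs => (le_max_left _ _).trans (hR _ hs)⟩⟩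

theorem Nice.marg {h : ℝ × (Fin n → ℝ) → ℝ} (hh : Nice h) : Nice (fun x => ∫ s, h (s, x)) := by
  obtain ⟨M, hM⟩ := hh.bdd
  obtain ⟨R, hR⟩ := hh.supp
  refine ⟨?_, fun x => integral_nonneg fun s => hh.nonneg _, ⟨∫ s, (Set.Icc (-R) R).indicator (fun _ => M) s, fun x => ?_⟩, ⟨R, fun x hx => ?_⟩⟩
  · exact (hh.meas.stronglyMeasurable.integral_prod_left').measurable
  · refine integral_mono (hh.slice x).integrable ?_ ?_
    · rw [integrable_indicator_iff measurableSet_Icc]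
      exact integrableOn_const (by simp)
    · intro s
      by_cases h0 : h (s, x) = 0
      · simp only [h0]
        exact Set.indicator_nonneg (fun _ _ => (hh.nonneg 0).trans (hM 0)) _
      · have h1 := (le_max_left _ _).trans (hR _ h0)
        have : s ∈ Set.Icc (-R) R := abs_le.mp h1
        simp only
        rw [Set.indicator_of_mem this]; exact hM _
  · by_contra hcon
    apply hx
    have : ∀ s, h (s, x) = 0 := by
      intro s
      by_contra h0
      exact hcon ((le_max_right _ _).trans (hR _ h0))
    simp [this]

/-- the functional Santalo type statement in dimension n -/
def Sant (n : ℕ) : Prop := ∀ (c : ENNReal) (f : (Fin n → ℝ) → ENNReal) (g : (Fin n → ℝ) → ℝ),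
  Measurable f → Nice g → (∀ i, ∫ y, y i * g y = 0) →
  (∀ x y, f x * ENNReal.ofReal (g y) ≤ c * ENNReal.ofReal (Real.exp (-(x ⬝ᵥ y)))) →
  (∫⁻ x, f x) * (∫⁻ y, ENNReal.ofReal (g y)) ≤ c * 16 ^ n

theorem half_step (hS : Sant n) (c : ENNReal) (h : ℝ × (Fin n → ℝ) → ℝ) (hh : Nice h)
    (hs : ∀ p, h p ≠ 0 → 0 ≤ p.1) (hc : ∀ i, ∫ p, p.2 i * h p = 0)
    (k : ℝ × (Fin n → ℝ) → ENNReal) (hk : Measurable k)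
    (hle : ∀ p q, 0 < p.1 → 0 < q.1 → ENNReal.ofReal (h p) * k q ≤ c * ENNReal.ofReal (Real.exp (-(p.1 * q.1 + p.2 ⬝ᵥ q.2)))) :
    (∫⁻ p, ENNReal.ofReal (h p)) * (∫⁻ q in {q | 0 ≤ q.1}, k q) ≤ 4 * c * 16 ^ n := by
  set h1 : (Fin n → ℝ) → ℝ := fun x => ∫ s, h (s, x) with hh1
  set k1 : (Fin n → ℝ) → ENNReal := fun y => ∫⁻ r in Set.Ici 0, k (r, y) with hk1
  have e0 : ∀ x, ENNReal.ofReal (h1 x) = ∫⁻ s, ENNReal.ofReal (h (s, x)) := fun x =>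
    ofReal_integral_eq_lintegral_ofReal (hh.slice x).integrable (Filter.Eventually.of_forall fun s => hh.nonneg _)
  have hmeas : Measurable fun p => ENNReal.ofReal (h p) := hh.meas.ennreal_ofReal
  have e1 : ∫⁻ p, ENNReal.ofReal (h p) = ∫⁻ x, ENNReal.ofReal (h1 x) := by
    simp_rw [e0]
    rw [Measure.volume_eq_prod, lintegral_prod_symm _ hmeas.aemeasurable]
  have hset : {q : ℝ × (Fin n → ℝ) | 0 ≤ q.1} = Set.Ici (0:ℝ) ×ˢ (Set.univ : Set (Fin n → ℝ)) := by
    ext q; simp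
  have e2 : ∫⁻ q in {q | 0 ≤ q.1}, k q = ∫⁻ y, k1 y := by
    rw [hset, Measure.volume_eq_prod, ← Measure.prod_restrict, Measure.restrict_univ, lintegral_prod_symm _ hk.aemeasurable]
  have hk1m : Measurable k1 := hk.lintegral_prod_left'
  rw [e1, e2, mul_comm]
  refine hS (4 * c) k1 h1 hk1m hh.marg ?_ ?_
  · intro i
    rw [← hc i, Measure.volume_eq_prod, integral_prod_symm]
    · congr 1; ext y
      rw [integral_const_mul]
    · rw [← Measure.volume_eq_prod]
      exact hh.integrable_mul (fun p => p.2 i) (by fun_prop)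
  · intro y x
    have e3 : ∫⁻ s, ENNReal.ofReal (h (s, x)) = ∫⁻ s in Set.Ioi 0, ENNReal.ofReal (h (s, x)) := by
      rw [setLIntegral_congr Ioi_ae_eq_Ici, ← lintegral_indicator measurableSet_Ici]
      congr 1; ext s
      by_cases h0 : h (s, x) = 0
      · simp [Set.indicator_apply, h0]
      · have : s ∈ Set.Ici (0:ℝ) := hs _ h0
        rw [Set.indicator_of_mem this]
    have e4 : k1 y = ∫⁻ r in Set.Ioi 0, k (r, y) := by
      rw [hk1]; simp only; rw [setLIntegral_congr Ioi_ae_eq_Ici]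
    rw [e0, mul_comm, e3, e4, mul_assoc]
    refine oned _ _ (hmeas.comp (by fun_prop)) (hk.comp (by fun_prop)) _ ?_ ?_
    · change ∫⁻ s in Set.Ioi 0, ENNReal.ofReal (h (s, x)) ≠ ⊤
      rw [← e3, ← e0]; exact ENNReal.ofReal_ne_top
    · intro s hs t ht
      refine (hle (s, x) (t, y) hs ht).trans (le_of_eq ?_)
      rw [mul_assoc, ← ENNReal.ofReal_mul (Real.exp_pos _).le, ← Real.exp_add, dotProduct_comm y x]
      congr 3; simp only; ring

end nice

section shear
variable {n : ℕ}

/-- affine shear -/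
def shT (σ t0 : ℝ) (z w : Fin n → ℝ) (p : ℝ × (Fin n → ℝ)) : ℝ × (Fin n → ℝ) :=
  (t0 + σ * p.1, z + p.2 + (σ * p.1) • w)

/-- dual shear -/
def shU (σ : ℝ) (w : Fin n → ℝ) (q : ℝ × (Fin n → ℝ)) : ℝ × (Fin n → ℝ) :=
  (σ * q.1 - w ⬝ᵥ q.2, q.2)

theorem mp_aff (σ a : ℝ) (hσ : |σ| = 1) : MeasurePreserving (fun s : ℝ => a + σ * s) := by
  rcases (abs_eq one_pos.le).mp hσ with rfl | rfl
  · simpa using measurePreserving_add_left (volume : Measure ℝ) a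
  · simpa [sub_eq_add_neg] using Measure.measurePreserving_sub_left (volume : Measure ℝ) a

theorem shT_mp (σ t0 : ℝ) (hσ : |σ| = 1) (z w : Fin n → ℝ) : MeasurePreserving (shT σ t0 z w) := by
  rw [Measure.volume_eq_prod]
  refine MeasurePreserving.skew_product (f := fun s => t0 + σ * s) (g := fun s x => z + x + (σ * s) • w) (mp_aff σ t0 hσ) ?_ ?_
  · fun_prop
  · refine Filter.Eventually.of_forall fun s => ?_
    have := (measurePreserving_add_left (volume : Measure (Fin n → ℝ)) (z + (σ * s) • w)).map_eq
    rw [← this]; congr 1; ext x; simp; ring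

theorem shU_mp (σ : ℝ) (hσ : |σ| = 1) (w : Fin n → ℝ) : MeasurePreserving (shU σ w) := by
  rw [Measure.volume_eq_prod]
  have h1 : MeasurePreserving (fun p : (Fin n → ℝ) × ℝ => (p.1, σ * p.2 - w ⬝ᵥ p.1)) (volume.prod volume) (volume.prod volume) := by
    refine MeasurePreserving.skew_product (f := fun y => y) (g := fun y r => σ * r - w ⬝ᵥ y) (MeasurePreserving.id _) ?_ ?_
    · unfold dotProduct; fun_prop
    · refine Filter.Eventually.of_forall fun y => ?_
      have := (mp_aff σ (-(w ⬝ᵥ y)) hσ).map_eq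
      rw [← this]; rw [this, ← this]; congr 1; ext r; ring
  have h2 := (Measure.measurePreserving_swap (μ := (volume : Measure (Fin n → ℝ))) (ν := (volume : Measure ℝ))).comp
    (h1.comp (Measure.measurePreserving_swap (μ := (volume : Measure ℝ)) (ν := (volume : Measure (Fin n → ℝ)))))
  exact h2

theorem half_step2 (hS : Sant n) (c : ENNReal) (F : ℝ × (Fin n → ℝ) → ℝ) (hF : Nice F)
    (G : ℝ × (Fin n → ℝ) → ENNReal) (hG : Measurable G)
    (hle : ∀ p q, ENNReal.ofReal (F p) * G q ≤ c * ENNReal.ofReal (Real.exp (-(p.1 * q.1 + p.2 ⬝ᵥ q.2))))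
    (σ t0 : ℝ) (hσ : |σ| = 1) (z w : Fin n → ℝ)
    (hc : ∀ i, ∫ p in {p : ℝ × (Fin n → ℝ) | 0 ≤ σ * (p.1 - t0)}, (p.2 i - z i - (p.1 - t0) * w i) * F p = 0) :
    (∫⁻ p in {p | 0 ≤ σ * (p.1 - t0)}, ENNReal.ofReal (F p)) *
      (∫⁻ q in {q | 0 ≤ σ * (q.1 + w ⬝ᵥ q.2)}, G q * ENNReal.ofReal (Real.exp (t0 * q.1 + z ⬝ᵥ q.2))) ≤ 4 * c * 16 ^ n := by
  have hσ2 : σ * σ = 1 := by rw [← abs_mul_abs_self, hσ, one_mul]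
  set S := {p : ℝ × (Fin n → ℝ) | 0 ≤ p.1} with hSdef
  have hSm : MeasurableSet S := measurableSet_le measurable_const measurable_fst
  have hS2 : {p : ℝ × (Fin n → ℝ) | 0 ≤ p.1} = shT σ t0 z w ⁻¹' {p | 0 ≤ σ * (p.1 - t0)} := by
    ext p; simp [shT, ← mul_assoc, hσ2]
  have hS2m : MeasurableSet {p : ℝ × (Fin n → ℝ) | 0 ≤ σ * (p.1 - t0)} := measurableSet_le measurable_const (by fun_prop)
  have hS3 : {p : ℝ × (Fin n → ℝ) | 0 ≤ p.1} = shU σ w ⁻¹' {q | 0 ≤ σ * (q.1 + w ⬝ᵥ q.2)} := by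
    ext p; simp [shU, ← mul_assoc, hσ2]
  have hT := shT_mp σ t0 hσ z w
  have hU := shU_mp σ hσ w
  have hS3m : MeasurableSet {q : ℝ × (Fin n → ℝ) | 0 ≤ σ * (q.1 + w ⬝ᵥ q.2)} :=
    measurableSet_le measurable_const (by unfold dotProduct; fun_prop)
  have hFT : Nice (fun p => F (shT σ t0 z w p)) := by
    obtain ⟨M, hM⟩ := hF.bdd
    obtain ⟨R, hR⟩ := hF.supp
    refine ⟨hF.meas.comp hT.measurable, fun p => hF.nonneg _, ⟨M, fun p => hM _⟩,
      ⟨max (R + |t0|) (R + ‖z‖ + (R + |t0|) * ‖w‖), fun p hp => ?_⟩⟩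
    have h1 := hR _ hp
    have h2 : |t0 + σ * p.1| ≤ R := (le_max_left _ _).trans h1
    have h3 : ‖z + p.2 + (σ * p.1) • w‖ ≤ R := (le_max_right _ _).trans h1
    have h4 : |p.1| ≤ R + |t0| := by
      have : |p.1| = |σ * p.1| := by rw [abs_mul, hσ, one_mul]
      rw [this]
      have h5 := abs_sub (t0 + σ * p.1) t0
      rw [add_sub_cancel_left] at h5; linarith
    refine max_le_max h4 ?_
    have h6 : p.2 = (z + p.2 + (σ * p.1) • w) - z - (σ * p.1) • w := by abel
    calc ‖p.2‖ = ‖(z + p.2 + (σ * p.1) • w) - z - (σ * p.1) • w‖ := by rw [← h6]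
      _ ≤ ‖z + p.2 + (σ * p.1) • w‖ + ‖z‖ + ‖(σ * p.1) • w‖ := (norm_sub_le _ _).trans (by gcongr; exact norm_sub_le _ _)
      _ ≤ _ := by
        rw [norm_smul, Real.norm_eq_abs, abs_mul, hσ, one_mul]
        gcongr
  have hexpm : Measurable fun q : ℝ × (Fin n → ℝ) => ENNReal.ofReal (Real.exp (t0 * q.1 + z ⬝ᵥ q.2)) := by
    unfold dotProduct; fun_prop
  set G2 : ℝ × (Fin n → ℝ) → ENNReal := fun q => G q * ENNReal.ofReal (Real.exp (t0 * q.1 + z ⬝ᵥ q.2)) with hG2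
  have hG2m : Measurable G2 := hG.mul hexpm
  have key := half_step hS c (S.indicator (fun p => F (shT σ t0 z w p))) (hFT.indicator S hSm) ?_ ?_
    (fun q => G2 (shU σ w q)) (hG2m.comp hU.measurable) ?_
  · convert key using 2
    · rw [← hT.setLIntegral_comp_preimage hS2m hF.meas.ennreal_ofReal, ← hS2, ← lintegral_indicator hSm]
      congr 1; ext p
      by_cases hp : p ∈ S <;> simp [hp]
    · rw [← hU.setLIntegral_comp_preimage hS3m hG2m, ← hS3]
  · intro p hp
    by_contra hcon
    exact hp (Set.indicator_of_notMem (show p ∉ S from hcon) _)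
  · intro i
    have e1 : ∀ p, p.2 i * S.indicator (fun p => F (shT σ t0 z w p)) p =
        ({p : ℝ × (Fin n → ℝ) | 0 ≤ σ * (p.1 - t0)}.indicator (fun p => (p.2 i - z i - (p.1 - t0) * w i) * F p)) (shT σ t0 z w p) := by
      intro p
      by_cases hp : p ∈ S
      · have hp' : shT σ t0 z w p ∈ {p : ℝ × (Fin n → ℝ) | 0 ≤ σ * (p.1 - t0)} := by
          rw [hSdef, hS2] at hp; exact hp
        rw [Set.indicator_of_mem hp, Set.indicator_of_mem hp']
        congr 1
        simp [shT]; ring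
      · have hp' : shT σ t0 z w p ∉ {p : ℝ × (Fin n → ℝ) | 0 ≤ σ * (p.1 - t0)} := by
          rw [hSdef, hS2] at hp; exact hp
        rw [Set.indicator_of_notMem hp, Set.indicator_of_notMem hp', mul_zero]
    simp_rw [e1]
    refine Eq.trans ?_ (hc i)
    rw [← integral_indicator hS2m]
    have h7 : Measurable ({p : ℝ × (Fin n → ℝ) | 0 ≤ σ * (p.1 - t0)}.indicator (fun p => (p.2 i - z i - (p.1 - t0) * w i) * F p)) := by
      refine Measurable.indicator ?_ hS2m
      have := hF.meas
      fun_prop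
    have := integral_map (μ := volume) hT.measurable.aemeasurable (h7.aestronglyMeasurable)
    rw [hT.map_eq] at this
    exact this.symm
  · intro p q hp hq
    rw [Set.indicator_of_mem (show p ∈ S from hp.le)]
    rw [hG2]; simp only
    rw [← mul_assoc]
    refine (mul_le_mul_left (hle _ _) _).trans (le_of_eq ?_)
    rw [mul_assoc, ← ENNReal.ofReal_mul (Real.exp_pos _).le, ← Real.exp_add]
    congr 3
    simp only [shT, shU, add_dotProduct, smul_dotProduct, smul_eq_mul]
    linear_combination (-p.1 * q.1) * hσ2

end shear

section fullstep
variable {n : ℕ}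

theorem median_prod (F : ℝ × (Fin n → ℝ) → ℝ) (hF : Nice F) (h0 : ∫⁻ p, ENNReal.ofReal (F p) ≠ 0) :
    ∃ t0 : ℝ, (∫⁻ p in {p | 0 ≤ (1:ℝ) * (p.1 - t0)}, ENNReal.ofReal (F p) = (∫⁻ p, ENNReal.ofReal (F p)) / 2) ∧
      (∫⁻ p in {p | 0 ≤ (-1:ℝ) * (p.1 - t0)}, ENNReal.ofReal (F p) = (∫⁻ p, ENNReal.ofReal (F p)) / 2) := by
  set ν : Measure (ℝ × (Fin n → ℝ)) := volume.withDensity (fun p => ENNReal.ofReal (F p)) with hν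
  set μ : Measure ℝ := ν.map Prod.fst with hμ
  have hfin : ∫⁻ p, ENNReal.ofReal (F p) ≠ ⊤ :=
    hF.integrable.lintegral_lt_top.ne
  have hu : μ Set.univ = ∫⁻ p, ENNReal.ofReal (F p) := by
    rw [hμ, Measure.map_apply measurable_fst MeasurableSet.univ, Set.preimage_univ, hν, withDensity_apply _ MeasurableSet.univ,
      Measure.restrict_univ]
  have : IsFiniteMeasure μ := ⟨by rw [hu]; exact hfin.lt_top⟩
  have : NullSingletonClass μ := ⟨by
    intro x
    rw [hμ, Measure.map_apply measurable_fst (measurableSet_singleton x)]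
    apply withDensity_absolutelyContinuous
    have : Prod.fst ⁻¹' {x} = ({x} : Set ℝ) ×ˢ (Set.univ : Set (Fin n → ℝ)) := by ext p; simp
    rw [this, Measure.volume_eq_prod, Measure.prod_prod]; simp⟩
  obtain ⟨t, h1, h2⟩ := exists_median μ (by
    intro h; apply h0; rw [← hu, h]; simp)
  rw [measure_congr Ioi_ae_eq_Ici] at h2
  refine ⟨t, ?_, ?_⟩
  · rw [← hu, ← h2, hμ, Measure.map_apply measurable_fst measurableSet_Ici, hν, withDensity_apply _ (measurable_fst measurableSet_Ici)]
    congr 2; ext p; simp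
  · rw [← hu, ← h1, hμ, Measure.map_apply measurable_fst measurableSet_Iic, hν, withDensity_apply _ (measurable_fst measurableSet_Iic)]
    congr 2; ext p; simp

theorem full_step_nice (hS : Sant n) (c : ENNReal) (F g : ℝ × (Fin n → ℝ) → ℝ) (hF : Nice F) (hg : Nice g)
    (hg1 : ∫ q, q.1 * g q = 0) (hg2 : ∀ i, ∫ q, q.2 i * g q = 0)
    (hle : ∀ p q, ENNReal.ofReal (F p) * ENNReal.ofReal (g q) ≤ c * ENNReal.ofReal (Real.exp (-(p.1 * q.1 + p.2 ⬝ᵥ q.2)))) :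
    (∫⁻ p, ENNReal.ofReal (F p)) * (∫⁻ q, ENNReal.ofReal (g q)) ≤ c * 16 ^ (n + 1) := by
  set a := ∫⁻ p, ENNReal.ofReal (F p) with ha
  by_cases h0 : a = 0
  · rw [h0]; simp
  have hatop : a ≠ ⊤ :=
    hF.integrable.lintegral_lt_top.ne
  obtain ⟨t0, hm1, hm2⟩ := median_prod F hF h0
  rw [← ha] at hm1 hm2
  set S : ℝ → Set (ℝ × (Fin n → ℝ)) := fun σ => {p | 0 ≤ σ * (p.1 - t0)} with hSdef
  have hSm : ∀ σ, MeasurableSet (S σ) := fun σ => measurableSet_le measurable_const (by fun_prop)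
  have hmint : ∀ σ, (∫⁻ p in S σ, ENNReal.ofReal (F p) = a / 2) → ∫ p in S σ, F p = (a / 2).toReal := by
    intro σ h
    rw [← h, integral_eq_lintegral_of_nonneg_ae (Filter.Eventually.of_forall fun p => hF.nonneg p) hF.meas.aestronglyMeasurable]
  set m := (a / 2).toReal with hm
  have hmpos : 0 < m := ENNReal.toReal_pos (by
    rw [Ne, ENNReal.div_eq_zero_iff]; simp [h0]) (ENNReal.div_ne_top hatop (by norm_num))
  set X : ℝ → Fin n → ℝ := fun σ i => ∫ p in S σ, p.2 i * F p with hX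
  set τ : ℝ → ℝ := fun σ => ∫ p in S σ, (p.1 - t0) * F p with hτ
  have hτ1 : 0 < τ 1 := by
    have hnn : 0 ≤ᵐ[volume.restrict (S 1)] fun p : ℝ × (Fin n → ℝ) => (p.1 - t0) * F p := by
      rw [Filter.EventuallyLE, ae_restrict_iff' (hSm 1)]
      refine Filter.Eventually.of_forall fun p hp => ?_
      have : 0 ≤ (1:ℝ) * (p.1 - t0) := hp
      exact mul_nonneg (by linarith) (hF.nonneg p)
    have hintg : IntegrableOn (fun p : ℝ × (Fin n → ℝ) => (p.1 - t0) * F p) (S 1) :=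
      (hF.integrable_mul (fun p => p.1 - t0) (by fun_prop)).integrableOn
    rcases (integral_nonneg_of_ae hnn).lt_or_eq with h | h
    · exact h
    · exfalso
      have h1 := (integral_eq_zero_iff_of_nonneg_ae hnn hintg).mp h.symm
      have hne : ∀ᵐ p : ℝ × (Fin n → ℝ) ∂volume.restrict (S 1), p.1 ≠ t0 := by
        apply ae_restrict_of_ae
        rw [ae_iff]
        have : {p : ℝ × (Fin n → ℝ) | ¬ p.1 ≠ t0} = ({t0} : Set ℝ) ×ˢ (Set.univ : Set (Fin n → ℝ)) := by ext p; simp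
        rw [this, Measure.volume_eq_prod, Measure.prod_prod]; simp
      have h2 : ∫ p in S 1, F p = 0 := by
        apply integral_eq_zero_of_ae
        filter_upwards [h1, hne] with p hp hp2
        simp only [Pi.zero_apply, mul_eq_zero] at hp ⊢
        rcases hp with hp | hp
        · exact absurd (by linarith) hp2
        · exact hp
      rw [hmint 1 hm1] at h2
      exact hmpos.ne' h2
  have hτ2 : τ (-1) ≤ 0 := by
    apply setIntegral_nonpos (hSm (-1))
    intro p hp
    have : 0 ≤ (-1:ℝ) * (p.1 - t0) := hp
    exact mul_nonpos_of_nonpos_of_nonneg (by linarith) (hF.nonneg p)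
  set w : Fin n → ℝ := fun i => (X 1 i - X (-1) i) / (τ 1 - τ (-1)) with hw
  set z : Fin n → ℝ := fun i => (X 1 i - τ 1 * w i) / m with hz
  have hlin : ∀ σ i, ∫ p in S σ, (p.2 i - z i - (p.1 - t0) * w i) * F p = X σ i - z i * (∫ p in S σ, F p) - τ σ * w i := by
    intro σ i
    have i1 : IntegrableOn (fun p : ℝ × (Fin n → ℝ) => p.2 i * F p) (S σ) := (hF.integrable_mul (fun p => p.2 i) (by fun_prop)).integrableOn
    have i2 : IntegrableOn (fun p : ℝ × (Fin n → ℝ) => z i * F p) (S σ) := (hF.integrable_mul (fun p => z i) (by fun_prop)).integrableOn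
    have i3 : IntegrableOn (fun p : ℝ × (Fin n → ℝ) => (p.1 - t0) * F p * w i) (S σ) :=
      ((hF.integrable_mul (fun p => p.1 - t0) (by fun_prop)).integrableOn).mul_const _
    have i4 : IntegrableOn (fun p : ℝ × (Fin n → ℝ) => p.2 i * F p - z i * F p) (S σ) := i1.sub i2
    rw [hX, hτ]; simp only
    rw [← integral_const_mul, ← integral_mul_const, ← integral_sub i1 i2, ← integral_sub i4 i3]
    congr 1; ext p; ring
  have hd : τ 1 - τ (-1) ≠ 0 := by linarith
  have hw' : ∀ i, (τ 1 - τ (-1)) * w i = X 1 i - X (-1) i := fun i => by rw [hw]; field_simp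
  have hz' : ∀ i, z i * m = X 1 i - τ 1 * w i := fun i => by rw [hz]; field_simp
  have k1 := half_step2 hS c F hF (fun q => ENNReal.ofReal (g q)) hg.meas.ennreal_ofReal hle 1 t0 (by simp) z w (by
    intro i
    refine (hlin 1 i).trans ?_
    rw [hmint 1 hm1, hz']; ring)
  have k2 := half_step2 hS c F hF (fun q => ENNReal.ofReal (g q)) hg.meas.ennreal_ofReal hle (-1) t0 (by simp) z w (by
    intro i
    refine (hlin (-1) i).trans ?_
    rw [hmint (-1) hm2, hz']
    linarith [hw' i])
  rw [hm1] at k1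
  rw [hm2] at k2
  set A : ℝ → Set (ℝ × (Fin n → ℝ)) := fun σ => {q | 0 ≤ σ * (q.1 + w ⬝ᵥ q.2)} with hA
  set G2 : ℝ × (Fin n → ℝ) → ENNReal := fun q => ENNReal.ofReal (g q) * ENNReal.ofReal (Real.exp (t0 * q.1 + z ⬝ᵥ q.2)) with hG2
  have hcov : ∫⁻ q, G2 q ≤ (∫⁻ q in A 1, G2 q) + ∫⁻ q in A (-1), G2 q := by
    have : A 1 ∪ A (-1) = Set.univ := by
      ext q; simp only [hA, Set.mem_union, Set.mem_ofPred_eq, Set.mem_univ, iff_true]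
      rcases le_total 0 (q.1 + w ⬝ᵥ q.2) with h | h
      · left; linarith
      · right; linarith
    rw [← setLIntegral_univ, ← this]
    exact lintegral_union_le _ _ _
  have hlow : ∫⁻ q, ENNReal.ofReal (g q) ≤ ∫⁻ q, G2 q := by
    have i0 : Continuous fun q : ℝ × (Fin n → ℝ) => z ⬝ᵥ q.2 := by unfold dotProduct; fun_prop
    have i1 : Integrable (fun q => (1 + (t0 * q.1 + z ⬝ᵥ q.2)) * g q) := hg.integrable_mul (fun q => 1 + (t0 * q.1 + z ⬝ᵥ q.2)) (by fun_prop)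
    have i2 : Integrable (fun q => Real.exp (t0 * q.1 + z ⬝ᵥ q.2) * g q) := hg.integrable_mul (fun q => Real.exp (t0 * q.1 + z ⬝ᵥ q.2)) (by fun_prop)
    have j1 : Integrable (fun q => t0 * (q.1 * g q)) := (hg.integrable_mul (fun q => q.1) (by fun_prop)).const_mul _
    have j2 : ∀ i ∈ Finset.univ, Integrable (fun q => z i * (q.2 i * g q)) := fun i _ => (hg.integrable_mul (fun q => q.2 i) (by fun_prop)).const_mul _
    have e1 : ∫ q, (1 + (t0 * q.1 + z ⬝ᵥ q.2)) * g q = ∫ q, g q := by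
      have : ∀ q : ℝ × (Fin n → ℝ), (1 + (t0 * q.1 + z ⬝ᵥ q.2)) * g q = g q + (t0 * (q.1 * g q) + ∑ i, z i * (q.2 i * g q)) := by
        intro q
        have : ∑ i, z i * (q.2 i * g q) = (z ⬝ᵥ q.2) * g q := by
          unfold dotProduct; rw [Finset.sum_mul]; congr 1; ext i; ring
        rw [this]; ring
      simp_rw [this]
      rw [integral_add hg.integrable (show Integrable (fun q : ℝ × (Fin n → ℝ) => t0 * (q.1 * g q) + ∑ i, z i * (q.2 i * g q)) from j1.add (integrable_finsetSum _ j2)), integral_add j1 (integrable_finsetSum _ j2),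
        integral_finsetSum _ j2]
      simp_rw [integral_const_mul, hg1, hg2]
      simp
    have e2 : ∫ q, g q ≤ ∫ q, Real.exp (t0 * q.1 + z ⬝ᵥ q.2) * g q := by
      rw [← e1]
      refine integral_mono i1 i2 fun q => ?_
      have := Real.add_one_le_exp (t0 * q.1 + z ⬝ᵥ q.2)
      exact mul_le_mul_of_nonneg_right (by linarith) (hg.nonneg q)
    have e3 : ∫⁻ q, G2 q = ENNReal.ofReal (∫ q, Real.exp (t0 * q.1 + z ⬝ᵥ q.2) * g q) := by
      rw [ofReal_integral_eq_lintegral_ofReal i2 (Filter.Eventually.of_forall fun q => mul_nonneg (Real.exp_pos _).le (hg.nonneg q))]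
      congr 1; ext q
      rw [ENNReal.ofReal_mul (Real.exp_pos _).le, mul_comm]
    rw [e3, ← ofReal_integral_eq_lintegral_ofReal hg.integrable (Filter.Eventually.of_forall fun q => hg.nonneg q)]
    exact ENNReal.ofReal_le_ofReal e2
  calc a * (∫⁻ q, ENNReal.ofReal (g q)) ≤ a * ((∫⁻ q in A 1, G2 q) + ∫⁻ q in A (-1), G2 q) := by gcongr; exact hlow.trans hcov
    _ = 2 * (a / 2 * (∫⁻ q in A 1, G2 q) + a / 2 * ∫⁻ q in A (-1), G2 q) := by
        rw [← mul_add, ← mul_assoc, ENNReal.mul_div_cancel (by norm_num) (by norm_num)]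
    _ ≤ 2 * (4 * c * 16 ^ n + 4 * c * 16 ^ n) := by gcongr
    _ = c * 16 ^ (n + 1) := by ring

end fullstep

section santalo
variable {n : ℕ}

theorem full_step (hS : Sant n) (c : ENNReal) (f : ℝ × (Fin n → ℝ) → ENNReal) (hf : Measurable f)
    (g : ℝ × (Fin n → ℝ) → ℝ) (hg : Nice g)
    (hg1 : ∫ q, q.1 * g q = 0) (hg2 : ∀ i, ∫ q, q.2 i * g q = 0)
    (hle : ∀ p q, f p * ENNReal.ofReal (g q) ≤ c * ENNReal.ofReal (Real.exp (-(p.1 * q.1 + p.2 ⬝ᵥ q.2)))) :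
    (∫⁻ p, f p) * (∫⁻ q, ENNReal.ofReal (g q)) ≤ c * 16 ^ (n + 1) := by
  classical
  set fk : ℕ → ℝ × (Fin n → ℝ) → ENNReal := fun k =>
    (Metric.closedBall (0 : ℝ × (Fin n → ℝ)) k).indicator (fun p => min (f p) k) with hfk
  have hm : ∀ k, Measurable (fk k) := fun k => (hf.min measurable_const).indicator Metric.isClosed_closedBall.measurableSet
  have hlek : ∀ k p, fk k p ≤ k := by
    intro k p
    rw [hfk]; simp only [Set.indicator_apply]
    split_ifs
    · exact min_le_right _ _
    · simp
  have hlef : ∀ k p, fk k p ≤ f p := by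
    intro k p
    rw [hfk]; simp only [Set.indicator_apply]
    split_ifs
    · exact min_le_left _ _
    · simp
  have hmono : Monotone fk := by
    intro k l hkl p
    rw [hfk]; simp only [Set.indicator_apply]
    have hkl' : (k : ℝ) ≤ l := by exact_mod_cast hkl
    split_ifs with h1 h2
    · exact min_le_min le_rfl (by exact_mod_cast hkl)
    · exact absurd (Metric.closedBall_subset_closedBall hkl' h1) h2
    · simp
    · simp
  have hsup : ∀ p, ⨆ k, fk k p = f p := by
    intro p
    apply le_antisymm (iSup_le fun k => hlef k p)
    obtain ⟨k0, hk0⟩ := exists_nat_ge ‖p‖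
    have hev : ∀ k, k0 ≤ k → fk k p = min (f p) k := by
      intro k hk
      have : (k0 : ℝ) ≤ k := by exact_mod_cast hk
      rw [hfk]; simp only
      rw [Set.indicator_of_mem (by simp; linarith)]
    apply le_of_forall_lt
    intro b hb
    obtain ⟨k1, hk1⟩ := ENNReal.exists_nat_gt (ne_top_of_lt hb)
    refine lt_of_lt_of_le ?_ (le_iSup (fun k => fk k p) (max k0 k1))
    rw [hev _ (le_max_left _ _)]
    exact lt_min hb (hk1.trans_le (by exact_mod_cast le_max_right _ _))
  have hintg : ∫⁻ p, f p = ⨆ k, ∫⁻ p, fk k p := by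
    rw [← lintegral_iSup hm hmono]; congr 1; ext p; rw [hsup]
  rw [hintg, ENNReal.iSup_mul]
  refine iSup_le fun k => ?_
  have hne : ∀ p, fk k p ≠ ⊤ := fun p => ne_top_of_le_ne_top (by simp) (hlek k p)
  have hnice : Nice (fun p => (fk k p).toReal) := by
    refine ⟨(hm k).ennreal_toReal, fun p => ENNReal.toReal_nonneg, ⟨k, fun p => ?_⟩, ⟨k, fun p hp => ?_⟩⟩
    · exact ENNReal.toReal_le_of_le_ofReal (by positivity) (by simpa using hlek k p)
    · by_contra hcon
      apply hp
      rw [hfk]; simp only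
      rw [Set.indicator_of_notMem (by simpa using hcon)]; simp
  have := full_step_nice hS c _ g hnice hg hg1 hg2 (by
    intro p q
    rw [ENNReal.ofReal_toReal (hne p)]
    exact (mul_le_mul_left (hlef k p) _).trans (hle p q))
  simpa only [ENNReal.ofReal_toReal (hne _)] using this

theorem sant_succ (hS : Sant n) : Sant (n + 1) := by
  intro c f g hf hg hc hle
  set e := MeasurableEquiv.piFinSuccAbove (fun _ : Fin (n + 1) => ℝ) 0 with he
  have hmp : MeasurePreserving e.symm :=
    (volume_preserving_piFinSuccAbove (fun _ : Fin (n + 1) => ℝ) 0).symm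
  have h0 : ∀ p, e.symm p 0 = p.1 := fun p => by simp [he, MeasurableEquiv.piFinSuccAbove]
  have h1 : ∀ p (i : Fin n), e.symm p i.succ = p.2 i := fun p i => by simp [he, MeasurableEquiv.piFinSuccAbove]
  have hdot : ∀ p q, e.symm p ⬝ᵥ e.symm q = p.1 * q.1 + p.2 ⬝ᵥ q.2 := by
    intro p q
    unfold dotProduct
    rw [Fin.sum_univ_succ]; simp only [h0, h1]
  have hnice : Nice (fun q => g (e.symm q)) := by
    obtain ⟨M, hM⟩ := hg.bdd
    obtain ⟨R, hR⟩ := hg.supp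
    refine ⟨hg.meas.comp hmp.measurable, fun p => hg.nonneg _, ⟨M, fun p => hM _⟩, ⟨R, fun p hp => ?_⟩⟩
    have h2 := hR _ hp
    have hR0 : 0 ≤ R := (norm_nonneg _).trans h2
    refine max_le ?_ ?_
    · rw [← h0 p]; exact (norm_le_pi_norm _ _).trans h2
    · rw [pi_norm_le_iff_of_nonneg hR0]
      intro i
      rw [← h1 p i]; exact (norm_le_pi_norm _ _).trans h2
  have hintg : ∀ φ : (Fin (n+1) → ℝ) → ℝ, ∫ q, φ (e.symm q) = ∫ y, φ y := fun φ => hmp.integral_comp' φ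
  have key := full_step hS c (fun p => f (e.symm p)) (hf.comp hmp.measurable) (fun q => g (e.symm q)) hnice ?_ ?_ ?_
  · rw [hmp.lintegral_comp hf, hmp.lintegral_comp hg.meas.ennreal_ofReal] at key
    exact key
  · rw [← hc 0, ← hintg]; simp only [h0]
  · intro i; rw [← hc i.succ, ← hintg]; simp only [h1]
  · intro p q
    rw [← hdot]; exact hle _ _

theorem sant_zero : Sant 0 := by
  intro c f g hf hg hc hle
  rw [lintegral_unique, lintegral_unique]
  have hv : (volume : Measure (Fin 0 → ℝ)) Set.univ = 1 := by
    simp [volume_pi, Measure.pi_of_empty]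
  rw [hv]
  have := hle default default
  rw [show ((default : Fin 0 → ℝ) ⬝ᵥ (default : Fin 0 → ℝ)) = 0 by unfold dotProduct; simp] at this
  simp only [mul_one, pow_zero, neg_zero, Real.exp_zero, ENNReal.ofReal_one] at this ⊢
  convert this

theorem sant_all : ∀ n, Sant n
  | 0 => sant_zero
  | n + 1 => sant_succ (sant_all n)

theorem santalo (K : Set (EuclideanSpace ℝ (Fin n))) (hK : IsCompact K) (hcen : ∫ x in K, x = 0) :
    volume K * volume (pol K) ≤ ENNReal.ofReal (48 ^ n / n.factorial) := by
  have hmp : MeasurePreserving (WithLp.toLp 2 : (Fin n → ℝ) → EuclideanSpace ℝ (Fin n)) :=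
    PiLp.volume_preserving_toLp (Fin n)
  set D := (n : ℝ) • pol K with hD
  have hDm : MeasurableSet D := by
    rcases Nat.eq_zero_or_pos n with h | h
    · subst h
      have : D = {0} := by
        rw [hD]; simp only [Nat.cast_zero]
        exact Set.zero_smul_set ⟨0, pol_zero K⟩
      rw [this]; exact measurableSet_singleton _
    · exact ((pol_closed K).smul_of_ne_zero (by positivity)).measurableSet
  have hKm := hK.measurableSet
  have key := sant_all n 1 (fun x => D.indicator (fun _ => ENNReal.ofReal (Real.exp (-n))) (WithLp.toLp 2 x))
    (fun y => K.indicator (fun _ => (1:ℝ)) (WithLp.toLp 2 y)) ?_ ?_ ?_ ?_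
  · have e1 : ∫⁻ x : Fin n → ℝ, D.indicator (fun _ => ENNReal.ofReal (Real.exp (-n))) (WithLp.toLp 2 x)
        = ENNReal.ofReal (Real.exp (-n)) * volume D := by
      rw [hmp.lintegral_comp (measurable_const.indicator hDm), lintegral_indicator_const hDm]
    have e2 : ∫⁻ y : Fin n → ℝ, ENNReal.ofReal (K.indicator (fun _ => (1:ℝ)) (WithLp.toLp 2 y)) = volume K := by
      rw [hmp.lintegral_comp (f := fun y => ENNReal.ofReal (K.indicator (fun _ => (1:ℝ)) y)) (measurable_const.indicator hKm).ennreal_ofReal,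
        ← lintegral_indicator_one hKm]
      congr 1; ext y
      by_cases hy : y ∈ K <;> simp [hy]
    rw [e1, e2, hD, vol_smul _ (by positivity), ← mul_assoc, ← ENNReal.ofReal_mul (Real.exp_pos _).le, one_mul] at key
    have hfac : (0:ℝ) < n.factorial := by exact_mod_cast n.factorial_pos
    have hexp : Real.exp (-n) = (Real.exp 1 ^ n)⁻¹ := by
      rw [← Real.exp_nat_mul, Real.exp_neg]; simp
    have h3 : 1 ≤ 3 ^ n / (n.factorial : ℝ) * (Real.exp (-n) * n ^ n) := by
      rw [hexp]
      have h4 : Real.exp 1 ^ n ≤ 3 ^ n := by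
        gcongr
        linarith [Real.exp_one_lt_d9]
      have h5 : (n.factorial : ℝ) ≤ n ^ n := by exact_mod_cast Nat.factorial_le_pow n
      have h6 : (0:ℝ) < Real.exp 1 ^ n := by positivity
      rw [div_mul_eq_mul_div, le_div_iff₀ hfac, one_mul]
      calc (n.factorial : ℝ) ≤ 1 * n ^ n := by linarith
        _ ≤ (3 ^ n * (Real.exp 1 ^ n)⁻¹) * n ^ n := by
          gcongr
          rw [← div_eq_mul_inv, le_div_iff₀ h6]; linarith
        _ = _ := by ring
    calc volume K * volume (pol K) = ENNReal.ofReal 1 * (volume K * volume (pol K)) := by simp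
      _ ≤ ENNReal.ofReal (3 ^ n / (n.factorial : ℝ) * (Real.exp (-n) * n ^ n)) * (volume K * volume (pol K)) := by
        gcongr
      _ = ENNReal.ofReal (3 ^ n / (n.factorial : ℝ)) * (ENNReal.ofReal (Real.exp (-n) * n ^ n) * volume (pol K) * volume K) := by
        rw [ENNReal.ofReal_mul (by positivity)]; ring
      _ ≤ ENNReal.ofReal (3 ^ n / (n.factorial : ℝ)) * 16 ^ n := by gcongr
      _ = _ := by
        rw [show (16 : ENNReal) ^ n = ENNReal.ofReal (16 ^ n) by rw [ENNReal.ofReal_pow (by norm_num)]; simp,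
          ← ENNReal.ofReal_mul (by positivity), div_mul_eq_mul_div, ← mul_pow]
        norm_num
  · exact (measurable_const.indicator hDm).comp hmp.measurable
  · obtain ⟨R, hR⟩ := hK.isBounded.exists_norm_le
    refine ⟨(measurable_const.indicator hKm).comp hmp.measurable, fun x => Set.indicator_nonneg (fun _ _ => zero_le_one) _,
      ⟨1, fun x => Set.indicator_le_self' (fun _ _ => zero_le_one) _⟩, ⟨R, fun x hx => ?_⟩⟩
    have hxK : WithLp.toLp 2 x ∈ K := by
      by_contra hcon
      exact hx (Set.indicator_of_notMem hcon _)
    have h1 := hR _ hxK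
    refine (pi_norm_le_iff_of_nonneg ((norm_nonneg _).trans h1)).mpr fun i => ?_
    exact (PiLp.norm_apply_le (WithLp.toLp 2 x) i).trans h1
  · intro i
    have e1 : ∫ y : Fin n → ℝ, y i * K.indicator (fun _ => (1:ℝ)) (WithLp.toLp 2 y)
       = ∫ x : EuclideanSpace ℝ (Fin n), K.indicator (fun x => x i) x := by
      have := integral_map (μ := volume) hmp.measurable.aemeasurable
        (f := fun x : EuclideanSpace ℝ (Fin n) => K.indicator (fun x => x i) x)
        (by
          refine Measurable.aestronglyMeasurable (Measurable.indicator ?_ hKm)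
          fun_prop)
      rw [hmp.map_eq] at this
      rw [this]
      congr 1; ext y
      by_cases hy : WithLp.toLp 2 y ∈ K <;> simp [hy]
    rw [e1, integral_indicator hKm]
    have h2 : IntegrableOn (fun x : EuclideanSpace ℝ (Fin n) => x) K :=
      continuous_id.continuousOn.integrableOn_compact hK
    have := (EuclideanSpace.proj i : EuclideanSpace ℝ (Fin n) →L[ℝ] ℝ).integral_comp_comm h2
    rw [hcen] at this
    simpa using this
  · intro x y
    by_cases hx : WithLp.toLp 2 x ∈ D
    · by_cases hy : WithLp.toLp 2 y ∈ K
      · rw [Set.indicator_of_mem hx, Set.indicator_of_mem hy]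
        simp only [ENNReal.ofReal_one, mul_one, one_mul]
        apply ENNReal.ofReal_le_ofReal
        apply Real.exp_le_exp.mpr
        apply neg_le_neg
        obtain ⟨u, hu, hux⟩ := hx
        have h1 := hu _ hy
        have h2 : x ⬝ᵥ y = n * inner ℝ (WithLp.toLp 2 y) u := by
          have : inner ℝ (WithLp.toLp 2 y) (WithLp.toLp 2 x) = x ⬝ᵥ y := by
            rw [EuclideanSpace.inner_toLp_toLp]; simp
          rw [← this, ← hux]; simp [real_inner_smul_right]
        rw [h2]
        have : (0:ℝ) ≤ n := by positivity
        nlinarith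
      · rw [Set.indicator_of_notMem hy]; simp
    · rw [Set.indicator_of_notMem hx]; simp

end santalo

section caps
variable {n : ℕ}

theorem zero_nhds (K : Set (EuclideanSpace ℝ (Fin n))) (hK : IsCompact K) (hc : Convex ℝ K)
    (hi : (interior K).Nonempty) (hcen : ∫ x in K, x = 0) : K ∈ nhds 0 := by
  rw [← mem_interior_iff_mem_nhds]
  by_contra h0
  obtain ⟨f, hf⟩ := geometric_hahn_banach_open_point hc.interior isOpen_interior h0
  rw [map_zero] at hf
  have hle : ∀ x ∈ K, f x ≤ 0 := by
    intro x hx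
    have hx2 : x ∈ closure (interior K) := by
      rw [hc.closure_interior_eq_closure_of_nonempty_interior hi]; exact subset_closure hx
    have : closure (interior K) ⊆ {x | f x ≤ 0} :=
      closure_minimal (fun x hx => (hf x hx).le) (isClosed_le f.continuous continuous_const)
    exact this hx2
  have h2 : IntegrableOn (fun x : EuclideanSpace ℝ (Fin n) => x) K :=
    continuous_id.continuousOn.integrableOn_compact hK
  have h3 := f.integral_comp_comm h2
  rw [hcen, map_zero] at h3
  have h4 : IntegrableOn (fun x => - f x) K := (f.continuous.neg).continuousOn.integrableOn_compact hK
  have h5 : 0 ≤ᵐ[volume.restrict K] fun x => - f x := by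
    rw [Filter.EventuallyLE, ae_restrict_iff' hK.measurableSet]
    exact Filter.Eventually.of_forall fun x hx => by simpa using hle x hx
  have h6 := (integral_eq_zero_iff_of_nonneg_ae h5 h4).mp (by rw [integral_neg, h3, neg_zero])
  have h7 : ∀ᵐ x ∂(volume.restrict (interior K)), False := by
    have h8 := ae_restrict_of_ae_restrict_of_subset interior_subset h6
    have h9 := ae_restrict_mem (μ := volume) (isOpen_interior (s := K)).measurableSet
    filter_upwards [h8, h9] with x hx hx2
    have := hf x hx2
    simp at hx
    linarith
  rw [Filter.eventually_false_iff_eq_bot, ae_eq_bot, Measure.restrict_eq_zero] at h7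
  exact (isOpen_interior.measure_pos volume hi).ne' h7

def cap (K : Set (EuclideanSpace ℝ (Fin n))) (y : EuclideanSpace ℝ (Fin n)) (δ : ℝ) : Set (EuclideanSpace ℝ (Fin n)) :=
  {w | w ∈ K ∧ 1 - δ ≤ inner ℝ w y}

theorem cap_convex (K : Set (EuclideanSpace ℝ (Fin n))) (hc : Convex ℝ K) (y : EuclideanSpace ℝ (Fin n)) (δ : ℝ) :
    Convex ℝ (cap K y δ) := by
  intro a ha b hb s t hs ht hst
  refine ⟨hc ha.1 hb.1 hs ht hst, ?_⟩
  rw [inner_add_left, real_inner_smul_left, real_inner_smul_left]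
  have h1 := mul_le_mul_of_nonneg_left ha.2 hs
  have h2 := mul_le_mul_of_nonneg_left hb.2 ht
  have : s * (1 - δ) + t * (1 - δ) = 1 - δ := by rw [← add_mul, hst, one_mul]
  linarith

theorem cap_compact (K : Set (EuclideanSpace ℝ (Fin n))) (hK : IsCompact K) (y : EuclideanSpace ℝ (Fin n)) (δ : ℝ) :
    IsCompact (cap K y δ) :=
  hK.inter_right (show IsClosed {w : EuclideanSpace ℝ (Fin n) | 1 - δ ≤ inner ℝ w y} from
    isClosed_le continuous_const (continuous_id.inner continuous_const))

theorem cap_int (K : Set (EuclideanSpace ℝ (Fin n))) (hc : Convex ℝ K) (hnh : K ∈ nhds 0)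
    (x y : EuclideanSpace ℝ (Fin n)) (hx : x ∈ K) (hxy : inner ℝ x y = 1) (δ : ℝ) (h0 : 0 < δ) (h1 : δ < 1) :
    cap K y δ ∈ nhds ((1 - δ/2) • x) := by
  refine Filter.inter_mem ?_ ?_
  · have hcont : Filter.Tendsto (fun w => (2/δ) • (w - (1 - δ/2) • x)) (nhds ((1 - δ/2) • x)) (nhds 0) := by
      have : Continuous fun w => (2/δ) • (w - (1 - δ/2) • x) := by fun_prop
      have h2 := this.tendsto ((1 - δ/2) • x)
      simpa using h2
    filter_upwards [hcont hnh] with w hw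
    have := hc hx hw (a := 1 - δ/2) (b := δ/2) (by linarith) (by linarith) (by ring)
    rw [smul_smul, show δ/2 * (2/δ) = 1 by field_simp, one_smul, add_sub_cancel] at this
    exact this
  · have hcont : Continuous fun w : EuclideanSpace ℝ (Fin n) => inner ℝ w y := by fun_prop
    have h2 : 1 - δ < inner ℝ ((1 - δ/2) • x) y := by
      rw [real_inner_smul_left, hxy]; linarith
    filter_upwards [hcont.continuousAt.eventually (lt_mem_nhds h2)] with w hw
    exact hw.le

theorem cap_product (hn : 1 ≤ n) (K : Set (EuclideanSpace ℝ (Fin n))) (hK : IsCompact K) (hc : Convex ℝ K) (hnh : K ∈ nhds 0)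
    (x y : EuclideanSpace ℝ (Fin n)) (hx : x ∈ K) (hy : y ∈ pol K) (hxy : inner ℝ x y = 1) (δ : ℝ) (h0 : 0 < δ) (h1 : δ < 1) :
    ENNReal.ofReal ((δ / 24) ^ n * δ * (Real.exp (-7) ^ n / n.factorial)) ≤ volume (cap K y δ) * volume (cap (pol K) x δ) := by
  set L := cap K y δ with hL
  have hLc : IsCompact L := cap_compact K hK y δ
  have hLconv : Convex ℝ L := cap_convex K hc y δ
  have hLn : L ∈ nhds ((1 - δ/2) • x) := cap_int K hc hnh x y hx hxy δ h0 h1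
  have hLv : volume L ≠ 0 := (Measure.measure_pos_of_mem_nhds volume hLn).ne'
  have hLL : IsCompact (L - L) := by
    rw [sub_eq_add_neg]; exact hLc.add hLc.neg
  have hrs := rogers_shephard L hLc hLconv hLv
  set c0 := (1 - δ/2) • x with hc0
  have hUn : L - L ∈ nhds (0 : EuclideanSpace ℝ (Fin n)) := by
    have hcont : Filter.Tendsto (fun w => w + c0) (nhds 0) (nhds c0) := by
      have : Continuous fun w : EuclideanSpace ℝ (Fin n) => w + c0 := by fun_prop
      simpa using this.tendsto 0
    filter_upwards [hcont hLn] with w hw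
    exact ⟨w + c0, hw, c0, mem_of_mem_nhds hLn, by simp⟩
  set φ : Module.Dual ℝ (EuclideanSpace ℝ (Fin n)) := (1/δ - 1) • (innerₛₗ ℝ y) with hφ
  set S := LinearMap.transvection φ x with hS
  have hSa : ∀ m, S m = m + ((1/δ - 1) * inner ℝ m y) • x := by
    intro m
    rw [hS, LinearMap.transvection.apply, hφ]
    simp [real_inner_comm]
  have hdet : LinearMap.det S = 1 / δ := by
    rw [hS, LinearMap.transvection.det, hφ]
    simp [real_inner_comm, hxy]
  have hcontS : Continuous S := S.continuous_of_finiteDimensional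
  set U := S '' (L - L) with hU
  have hUc : IsCompact U := hLL.image hcontS
  have hUconv : Convex ℝ U := (hLconv.sub hLconv).linear_image S
  have hdet0 : LinearMap.det S ≠ 0 := by rw [hdet]; positivity
  have hopen : IsOpenMap S := by
    apply LinearMap.isOpenMap_of_finiteDimensional
    exact (LinearMap.equivOfDetNeZero S hdet0).surjective
  have hUnh : U ∈ nhds 0 := by
    have := hopen.image_mem_nhds hUn
    simpa using this
  have hUs : ∀ u ∈ U, -u ∈ U := by
    rintro _ ⟨_, ⟨a, ha, b, hb, rfl⟩, rfl⟩
    exact ⟨b - a, ⟨b, hb, a, ha, rfl⟩, by rw [← map_neg, neg_sub]⟩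
  have hbm := bm_sym hn U hUconv hUc.isClosed hUnh hUc.isBounded hUs
  have hvolU : volume U = ENNReal.ofReal (1/δ) * volume (L - L) := by
    rw [hU, Measure.addHaar_image_linearMap, hdet, abs_of_pos (by positivity)]
  have hxL : x ∈ L := ⟨hx, by rw [hxy]; linarith⟩
  have h0K : (0 : EuclideanSpace ℝ (Fin n)) ∈ K := mem_of_mem_nhds hnh
  have hxU : x ∈ U := by
    refine ⟨δ • x, ⟨x, hxL, (1 - δ) • x, ⟨?_, ?_⟩, ?_⟩, ?_⟩
    · have := hc hx h0K (a := 1 - δ) (b := δ) (by linarith) (by linarith) (by ring)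
      simpa using this
    · rw [real_inner_smul_left, hxy]; linarith
    · simp only [sub_smul, one_smul]; abel
    · rw [hSa, real_inner_smul_left, hxy, ← add_smul]
      rw [show δ + (1/δ - 1) * (δ * 1) = 1 by field_simp; ring, one_smul]
  have hsub : ((1 - δ/2) • y) +ᵥ ((δ/6) • pol U) ⊆ cap (pol K) x δ := by
    rintro _ ⟨_, ⟨θ, hθ, rfl⟩, rfl⟩
    have hx1 : inner ℝ x θ ≤ 1 := hθ x hxU
    have hx2 : -1 ≤ inner ℝ x θ := by
      have := hθ _ (hUs x hxU)
      rw [inner_neg_left] at this; linarith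
    have hexp : ∀ w, inner ℝ w (((1 - δ/2) • y) +ᵥ ((δ/6) • θ)) = (1 - δ/2) * inner ℝ w y + δ/6 * inner ℝ w θ := by
      intro w
      rw [vadd_eq_add, inner_add_right, real_inner_smul_right, real_inner_smul_right]
    have hL2 : ∀ w ∈ L, inner ℝ (w - x) θ ≤ 2 := by
      intro w hw
      have k1 := hθ (S (w - x)) ⟨w - x, ⟨w, hw, x, hxL, rfl⟩, rfl⟩
      rw [hSa, inner_add_left, real_inner_smul_left] at k1
      have k2 : inner ℝ (w - x) y ≤ 0 := by
        rw [inner_sub_left, hxy]; linarith [hy w hw.1]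
      have k3 : -δ ≤ inner ℝ (w - x) y := by
        rw [inner_sub_left, hxy]; linarith [hw.2]
      have k4 : 0 < 1/δ - 1 := by rw [sub_pos, lt_div_iff₀ h0]; linarith
      have k5 : (1/δ - 1) * δ = 1 - δ := by field_simp
      set A := inner ℝ (w - x) y
      set B := inner ℝ x θ
      have k6 : -(A * B) ≤ δ := by nlinarith
      have k7 : (1/δ - 1) * (-(A * B)) ≤ 1 - δ := by
        rw [← k5]; exact mul_le_mul_of_nonneg_left k6 k4.le
      nlinarith
    refine ⟨?_, ?_⟩
    · intro w hw
      simp only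
      rw [hexp]
      have hwx : inner ℝ w θ = inner ℝ x θ + inner ℝ (w - x) θ := by rw [inner_sub_left]; ring
      by_cases hwL : w ∈ L
      · have k1 := hL2 w hwL
        have k2 := hy w hw
        rw [hwx]
        nlinarith
      · have hr : inner ℝ w y < 1 - δ := by
          by_contra hcon
          exact hwL ⟨hw, not_lt.mp hcon⟩
        set r := 1 - inner ℝ w y with hr'
        have hrδ : δ < r := by linarith
        have hr0 : 0 < r := by linarith
        have ht1 : δ / r < 1 := by rw [div_lt_one hr0]; exact hrδ
        have ht0 : 0 < δ / r := by positivity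
        have hwt : x + (δ / r) • (w - x) ∈ L := by
          refine ⟨?_, ?_⟩
          · have := hc hx hw (a := 1 - δ/r) (b := δ/r) (by linarith) ht0.le (by ring)
            convert this using 1
            rw [smul_sub, sub_smul, one_smul]; abel
          · rw [inner_add_left, real_inner_smul_left, inner_sub_left, hxy]
            have : δ / r * (inner ℝ w y - 1) = -δ := by
              rw [show inner ℝ w y - 1 = -r by rw [hr']; ring]; field_simp
            linarith
        have k1 := hL2 _ hwt
        rw [add_sub_cancel_left, real_inner_smul_left] at k1
        have k2 : δ * inner ℝ (w - x) θ ≤ 2 * r := by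
          rw [div_mul_eq_mul_div, div_le_iff₀ hr0] at k1; linarith
        have hwy : inner ℝ w y = 1 - r := by rw [hr']; ring
        rw [hwx, hwy]
        nlinarith
    · rw [real_inner_comm]
      simp only
      rw [hexp, hxy]
      nlinarith
  have hvol : ENNReal.ofReal ((δ/6)^n) * volume (pol U) ≤ volume (cap (pol K) x δ) := by
    rw [← vol_smul _ (by positivity), ← measure_vadd volume ((1 - δ/2) • y)]
    exact measure_mono hsub
  calc ENNReal.ofReal ((δ / 24) ^ n * δ * (Real.exp (-7) ^ n / n.factorial))
      = ENNReal.ofReal ((δ / 24) ^ n * δ) * ENNReal.ofReal (Real.exp (-7) ^ n / n.factorial) := by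
        rw [ENNReal.ofReal_mul (by positivity)]
    _ ≤ ENNReal.ofReal ((δ / 24) ^ n * δ) * (volume U * volume (pol U)) := by gcongr
    _ ≤ ENNReal.ofReal ((δ / 24) ^ n * δ) * ((ENNReal.ofReal (1/δ) * (ENNReal.ofReal (4^n) * volume L)) * volume (pol U)) := by
        rw [hvolU]; gcongr
    _ = ENNReal.ofReal (((δ / 24) ^ n * δ) * (1/δ) * 4^n) * (volume L * volume (pol U)) := by
        rw [ENNReal.ofReal_mul (p := (δ / 24) ^ n * δ * (1/δ)) (by positivity),
          ENNReal.ofReal_mul (p := (δ / 24) ^ n * δ) (q := 1/δ) (by positivity)]; ring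
    _ = volume L * (ENNReal.ofReal ((δ/6)^n) * volume (pol U)) := by
        rw [show ((δ / 24) ^ n * δ) * (1/δ) * 4^n = (δ/6)^n by
          rw [mul_assoc ((δ/24)^n), mul_one_div_cancel h0.ne', mul_one, ← mul_pow, show δ/24*4 = δ/6 by ring]]
        ring
    _ ≤ _ := by gcongr

end caps

section packing
variable {n : ℕ}

/-- shrunken cap -/
def capA (K : Set (EuclideanSpace ℝ (Fin n))) (x y : EuclideanSpace ℝ (Fin n)) (δ : ℝ) : Set (EuclideanSpace ℝ (Fin n)) :=
  ((3/4 : ℝ) • x) +ᵥ ((1/4 : ℝ) • cap K y δ)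

theorem capA_inner (K : Set (EuclideanSpace ℝ (Fin n))) (x y : EuclideanSpace ℝ (Fin n)) (δ : ℝ)
    (hxy : inner ℝ x y = 1) (p) (hp : p ∈ capA K x y δ) : 1 - δ/4 ≤ inner ℝ p y := by
  obtain ⟨_, ⟨w, hw, rfl⟩, rfl⟩ := hp
  simp only [vadd_eq_add, inner_add_left, real_inner_smul_left, hxy]
  linarith [hw.2]

theorem capA_meet (K : Set (EuclideanSpace ℝ (Fin n))) (x y x' y' : EuclideanSpace ℝ (Fin n)) (δ : ℝ)
    (hxy : inner ℝ x y = 1) (hy : ∀ w ∈ K, inner ℝ w y ≤ 1)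
    (h : ¬ Disjoint (capA K x y δ) (capA K x' y' δ)) : 1 - δ/3 ≤ inner ℝ x' y := by
  rw [Set.not_disjoint_iff] at h
  obtain ⟨p, hp, hp'⟩ := h
  have h1 := capA_inner K x y δ hxy p hp
  obtain ⟨_, ⟨w, hw, rfl⟩, rfl⟩ := hp'
  simp only [vadd_eq_add, inner_add_left, real_inner_smul_left] at h1
  linarith [hy w hw.1]

theorem capA_shell (K : Set (EuclideanSpace ℝ (Fin n))) (hc : Convex ℝ K) (x y : EuclideanSpace ℝ (Fin n)) (δ : ℝ)
    (h0 : 0 < δ) (h1 : δ < 1)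
    (hx : x ∈ K) (hxy : inner ℝ x y = 1) (hy : ∀ w ∈ K, inner ℝ w y ≤ 1) : capA K x y δ ⊆ K \ ((1 - δ) • K) := by
  intro p hp
  refine ⟨?_, ?_⟩
  · obtain ⟨_, ⟨w, hw, rfl⟩, rfl⟩ := hp
    exact hc hx hw.1 (by norm_num) (by norm_num) (by norm_num)
  · have h2 := capA_inner K x y δ hxy p hp
    rintro ⟨w, hw, rfl⟩
    simp only [real_inner_smul_left] at h2
    have := hy w hw
    nlinarith

theorem shell_vol (K : Set (EuclideanSpace ℝ (Fin n))) (hK : IsCompact K) (hc : Convex ℝ K) (hz : (0 : EuclideanSpace ℝ (Fin n)) ∈ K)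
    (δ : ℝ) (h0 : 0 < δ) (h1 : δ < 1) : volume.real (K \ ((1 - δ) • K)) ≤ n * δ * volume.real K := by
  have hsub : (1 - δ) • K ⊆ K := by
    rintro _ ⟨w, hw, rfl⟩
    have := hc hw hz (a := 1 - δ) (b := δ) (by linarith) (by linarith) (by ring)
    simpa using this
  have hv : volume.real ((1 - δ) • K) = (1 - δ)^n * volume.real K := by
    rw [measureReal_def, vol_smul _ (by linarith), ENNReal.toReal_mul, ENNReal.toReal_ofReal (pow_nonneg (by linarith) _), measureReal_def]
  rw [measureReal_diff hsub (hK.smul (1 - δ)).measurableSet hK.measure_lt_top.ne, hv]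
  have hb : 1 + n * (-δ) ≤ (1 + (-δ))^n := one_add_mul_le_pow (by linarith) n
  have h3 : 0 ≤ volume.real K := measureReal_nonneg
  rw [← sub_eq_add_neg] at hb
  have h4 := mul_le_mul_of_nonneg_right hb h3
  linarith

theorem capA_vol (K : Set (EuclideanSpace ℝ (Fin n))) (x y : EuclideanSpace ℝ (Fin n)) (δ : ℝ) :
    volume.real (capA K x y δ) = (1/4)^n * volume.real (cap K y δ) := by
  rw [measureReal_def, capA, measure_vadd, vol_smul _ (by norm_num), ENNReal.toReal_mul, ENNReal.toReal_ofReal (by positivity), measureReal_def]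

theorem sum_shell (K : Set (EuclideanSpace ℝ (Fin n))) (hK : IsCompact K) (hc : Convex ℝ K) (hz : (0 : EuclideanSpace ℝ (Fin n)) ∈ K)
    (δ : ℝ) (h0 : 0 < δ) (h1 : δ < 1) {ι : Type*} (Z : Finset ι) (X Y : ι → EuclideanSpace ℝ (Fin n))
    (hX : ∀ i ∈ Z, X i ∈ K) (hXY : ∀ i ∈ Z, inner ℝ (X i) (Y i) = 1) (hY : ∀ i ∈ Z, ∀ w ∈ K, inner ℝ w (Y i) ≤ 1)
    (hd : (Z : Set ι).PairwiseDisjoint fun i => capA K (X i) (Y i) δ) :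
    ∑ i ∈ Z, volume.real (capA K (X i) (Y i) δ) ≤ n * δ * volume.real K := by
  have hm : ∀ i ∈ Z, MeasurableSet (capA K (X i) (Y i) δ) := fun i _ =>
    (((cap_compact K hK (Y i) δ).smul (1/4 : ℝ)).vadd ((3/4:ℝ) • X i)).measurableSet
  have hfin : ∀ i ∈ Z, volume (capA K (X i) (Y i) δ) ≠ ⊤ := fun i _ =>
    (((cap_compact K hK (Y i) δ).smul (1/4 : ℝ)).vadd ((3/4:ℝ) • X i)).measure_lt_top.ne
  rw [← measureReal_biUnion_finset hd hm hfin]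
  refine (measureReal_mono ?_ ?_).trans (shell_vol K hK hc hz δ h0 h1)
  · intro p hp
    simp only [Set.mem_iUnion] at hp
    obtain ⟨i, hi, hp⟩ := hp
    exact capA_shell K hc (X i) (Y i) δ h0 h1 (hX i hi) (hXY i hi) (hY i hi) hp
  · exact ne_top_of_le_ne_top hK.measure_lt_top.ne (measure_mono Set.sdiff_subset)

/-- packing data: points paired with supporting functionals, disjoint shrunken caps -/
structure Pack (K : Set (EuclideanSpace ℝ (Fin n))) (δ : ℝ) (Z : Finset (EuclideanSpace ℝ (Fin n) × EuclideanSpace ℝ (Fin n))) : Prop where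
  mem : ∀ z ∈ Z, z.1 ∈ K
  mem' : ∀ z ∈ Z, z.2 ∈ pol K
  one : ∀ z ∈ Z, inner ℝ z.1 z.2 = 1
  disj : (Z : Set (EuclideanSpace ℝ (Fin n) × EuclideanSpace ℝ (Fin n))).PairwiseDisjoint fun z => capA K z.1 z.2 δ
  disj' : (Z : Set (EuclideanSpace ℝ (Fin n) × EuclideanSpace ℝ (Fin n))).PairwiseDisjoint fun z => capA (pol K) z.2 z.1 δ

theorem pack_card (hn : 1 ≤ n) (K : Set (EuclideanSpace ℝ (Fin n))) (hK : IsCompact K) (hc : Convex ℝ K) (hnh : K ∈ nhds 0)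
    (hcen : ∫ x in K, x = 0) (δ : ℝ) (h0 : 0 < δ) (h1 : δ < 1)
    (Z : Finset (EuclideanSpace ℝ (Fin n) × EuclideanSpace ℝ (Fin n))) (hZ : Pack K δ Z) :
    (Z.card : ℝ)^2 * δ ^ (n - 1) ≤ n^2 * (48 * 16 * 24 * Real.exp 7)^n := by
  have hpc := pol_compact K hnh
  have hfac : (0:ℝ) < n.factorial := by exact_mod_cast n.factorial_pos
  have s1 := sum_shell K hK hc (mem_of_mem_nhds hnh) δ h0 h1 Z (fun z => z.1) (fun z => z.2) hZ.mem hZ.one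
    (fun z hz w hw => hZ.mem' z hz w hw) hZ.disj
  have s2 := sum_shell (pol K) hpc (pol_convex K) (pol_zero K) δ h0 h1 Z (fun z => z.2) (fun z => z.1) hZ.mem'
    (fun z hz => by rw [real_inner_comm]; exact hZ.one z hz)
    (fun z hz w hw => by rw [real_inner_comm]; exact hw z.1 (hZ.mem z hz)) hZ.disj'
  set κ : ℝ := (1/16)^n * ((δ / 24) ^ n * δ * (Real.exp (-7) ^ n / n.factorial)) with hκ
  have hκ0 : 0 ≤ κ := by positivity
  have hprod : ∀ z ∈ Z, κ ≤ volume.real (capA K z.1 z.2 δ) * volume.real (capA (pol K) z.2 z.1 δ) := by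
    intro z hz
    rw [capA_vol, capA_vol]
    have := cap_product hn K hK hc hnh z.1 z.2 (hZ.mem z hz) (hZ.mem' z hz) (hZ.one z hz) δ h0 h1
    have f1 : volume (cap K z.2 δ) ≠ ⊤ := (cap_compact K hK z.2 δ).measure_lt_top.ne
    have f2 : volume (cap (pol K) z.1 δ) ≠ ⊤ := (cap_compact (pol K) hpc z.1 δ).measure_lt_top.ne
    rw [ENNReal.ofReal_le_iff_le_toReal (ENNReal.mul_ne_top f1 f2), ENNReal.toReal_mul] at this
    rw [measureReal_def, measureReal_def]
    calc κ ≤ (1/16)^n * ((volume (cap K z.2 δ)).toReal * (volume (cap (pol K) z.1 δ)).toReal) := by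
          rw [hκ]; gcongr
      _ = _ := by
          rw [show (1/16 : ℝ) = 1/4 * (1/4) by norm_num, mul_pow]; ring
  have hcs := Finset.sum_sq_le_sum_mul_sum_of_sq_le_mul Z (r := fun _ => Real.sqrt κ)
    (f := fun z => volume.real (capA K z.1 z.2 δ)) (g := fun z => volume.real (capA (pol K) z.2 z.1 δ))
    (fun _ _ => measureReal_nonneg) (fun _ _ => measureReal_nonneg)
    (fun z hz => by rw [Real.sq_sqrt hκ0]; exact hprod z hz)
  rw [Finset.sum_const, nsmul_eq_mul, mul_pow, Real.sq_sqrt hκ0] at hcs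
  have hsan : volume.real K * volume.real (pol K) ≤ 48 ^ n / n.factorial := by
    have := santalo K hK hcen
    rw [measureReal_def, measureReal_def, ← ENNReal.toReal_mul]
    exact ENNReal.toReal_le_of_le_ofReal (by positivity) this
  have hbig : (Z.card : ℝ)^2 * κ ≤ (n * δ)^2 * (48 ^ n / n.factorial) := by
    calc (Z.card : ℝ)^2 * κ ≤ _ := hcs
      _ ≤ (n * δ * volume.real K) * (n * δ * volume.real (pol K)) := by
        apply mul_le_mul s1 s2 (Finset.sum_nonneg fun _ _ => measureReal_nonneg) (by positivity)
      _ = (n * δ)^2 * (volume.real K * volume.real (pol K)) := by ring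
      _ ≤ _ := by gcongr
  have hexp : Real.exp (-7) * Real.exp 7 = 1 := by rw [← Real.exp_add]; simp
  have hδn : δ ^ n = δ ^ (n - 1) * δ := by rw [← pow_succ]; congr 1; omega
  have e1 : κ * (16 * 24 * Real.exp 7)^n * n.factorial = δ ^ (n - 1) * δ^2 := by
    rw [hκ]
    have : (1/16 : ℝ)^n * ((δ / 24) ^ n * δ * (Real.exp (-7) ^ n / n.factorial)) * (16 * 24 * Real.exp 7)^n * n.factorial
      = (1/16 * (δ/24) * Real.exp (-7) * (16 * 24 * Real.exp 7))^n * δ := by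
      rw [mul_pow (1/16 * (δ/24) * Real.exp (-7)), mul_pow (1/16 * (δ/24)), mul_pow (1/16)]
      generalize (16 * 24 * Real.exp 7)^n = A
      generalize Real.exp (-7)^n = B
      generalize (1/16:ℝ)^n = D
      generalize (δ/24)^n = F
      field_simp
    rw [this, show 1/16 * (δ/24) * Real.exp (-7) * (16 * 24 * Real.exp 7) = δ * (Real.exp (-7) * Real.exp 7) by ring, hexp, mul_one, hδn]
    ring
  have e2 : (Z.card : ℝ)^2 * δ ^ (n - 1) * δ^2 ≤ n^2 * (48 * 16 * 24 * Real.exp 7)^n * δ^2 := by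
    calc (Z.card : ℝ)^2 * δ ^ (n - 1) * δ^2 = ((Z.card : ℝ)^2 * κ) * ((16 * 24 * Real.exp 7)^n * n.factorial) := by
          rw [mul_assoc, ← e1]; ring
      _ ≤ ((n * δ)^2 * (48 ^ n / n.factorial)) * ((16 * 24 * Real.exp 7)^n * n.factorial) := by gcongr
      _ = _ := by
          rw [show (48 * 16 * 24 * Real.exp 7) = 48 * (16 * 24 * Real.exp 7) by ring, mul_pow 48]
          field_simp
  exact le_of_mul_le_mul_right e2 (by positivity)

end packing

section final
variable {n : ℕ}

theorem exists_max_pack (hn : 1 ≤ n) (K : Set (EuclideanSpace ℝ (Fin n))) (hK : IsCompact K) (hc : Convex ℝ K) (hnh : K ∈ nhds 0)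
    (hcen : ∫ x in K, x = 0) (δ : ℝ) (h0 : 0 < δ) (h1 : δ < 1) :
    ∃ Z, Pack K δ Z ∧ ∀ Z', Pack K δ Z' → Z'.card ≤ Z.card := by
  classical
  set S : Set ℕ := {k | ∃ Z, Pack K δ Z ∧ Z.card = k} with hS
  have hne : S.Nonempty := ⟨0, ∅, ⟨by simp, by simp, by simp, by simp, by simp⟩, rfl⟩
  have hb : BddAbove S := by
    refine ⟨⌈(n^2 * (48 * 16 * 24 * Real.exp 7)^n / δ ^ (n - 1) : ℝ)⌉₊, ?_⟩
    rintro k ⟨Z, hZ, rfl⟩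
    have := pack_card hn K hK hc hnh hcen δ h0 h1 Z hZ
    rw [← le_div_iff₀ (by positivity)] at this
    have h2 : (Z.card : ℝ) ≤ (Z.card : ℝ)^2 := by
      exact_mod_cast Nat.le_self_pow (by norm_num) _
    have h3 := (h2.trans this).trans (Nat.le_ceil _)
    exact_mod_cast h3
  obtain ⟨Z, hZ, hk⟩ := Nat.sSup_mem hne hb
  refine ⟨Z, hZ, fun Z' hZ' => ?_⟩
  rw [hk]
  exact le_csSup hb ⟨Z', hZ', rfl⟩

theorem pack_cover (K : Set (EuclideanSpace ℝ (Fin n))) (hK : IsCompact K) (hnh : K ∈ nhds 0)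
    (δ : ℝ) (h0 : 0 < δ) (h1 : δ < 1) (Z : Finset (EuclideanSpace ℝ (Fin n) × EuclideanSpace ℝ (Fin n))) (hZ : Pack K δ Z)
    (hmax : ∀ Z', Pack K δ Z' → Z'.card ≤ Z.card) (v : EuclideanSpace ℝ (Fin n)) (hv : v ≠ 0) :
    ∃ z ∈ Z, ∀ p ∈ K, (1 - δ) * inner ℝ p v ≤ inner ℝ z.1 v := by
  classical
  obtain ⟨x, hx, hxm⟩ := hK.exists_isMaxOn ⟨0, mem_of_mem_nhds hnh⟩
    (f := fun p => inner ℝ p v) (by fun_prop)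
  have hxm' : ∀ p ∈ K, inner ℝ p v ≤ inner ℝ x v := fun p hp => hxm hp
  set h : ℝ := inner ℝ x v with hh
  have hpos : 0 < h := by
    have ht : Filter.Tendsto (fun t : ℝ => t • v) (nhdsWithin 0 (Set.Ioi 0)) (nhds 0) := by
      have : Filter.Tendsto (fun t : ℝ => t • v) (nhds 0) (nhds ((0:ℝ) • v)) :=
        (continuous_id.smul continuous_const).tendsto 0
      rw [zero_smul] at this
      exact this.mono_left nhdsWithin_le_nhds
    obtain ⟨t, ht1, ht2⟩ := ((ht.eventually hnh).and self_mem_nhdsWithin).exists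
    have := hxm' _ ht1
    rw [real_inner_smul_left] at this
    have hvv : 0 < inner ℝ v v := real_inner_self_pos.2 hv
    exact (mul_pos ht2 hvv).trans_le this
  set y := h⁻¹ • v with hy
  have hyp : y ∈ pol K := by
    intro w hw
    rw [hy, real_inner_smul_right, inv_mul_le_iff₀ hpos, mul_one]
    exact hxm' w hw
  have hxy : inner ℝ x y = 1 := by
    rw [hy, real_inner_smul_right, ← hh, inv_mul_cancel₀ hpos.ne']
  suffices H : ∃ z ∈ Z, 1 - δ ≤ inner ℝ z.1 y by
    obtain ⟨z, hz, hzy⟩ := H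
    refine ⟨z, hz, fun p hp => ?_⟩
    have e : inner ℝ z.1 y = h⁻¹ * inner ℝ z.1 v := by rw [hy, real_inner_smul_right]
    rw [e, le_inv_mul_iff₀ hpos] at hzy
    nlinarith [hxm' p hp]
  by_cases hmem : (x, y) ∈ Z
  · exact ⟨_, hmem, by rw [hxy]; linarith⟩
  by_contra hno
  push Not at hno
  have hA : ∀ z ∈ Z, Disjoint (capA K x y δ) (capA K z.1 z.2 δ) := by
    intro z hz
    by_contra hd
    have := capA_meet K x y z.1 z.2 δ hxy hyp hd
    linarith [hno z hz]
  have hB : ∀ z ∈ Z, Disjoint (capA (pol K) y x δ) (capA (pol K) z.2 z.1 δ) := by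
    intro z hz
    by_contra hd
    rw [disjoint_comm] at hd
    have := capA_meet (pol K) z.2 z.1 y x δ (by rw [real_inner_comm]; exact hZ.one z hz)
      (fun w hw => by rw [real_inner_comm]; exact hw _ (hZ.mem z hz)) hd
    rw [real_inner_comm] at this
    linarith [hno z hz]
  have hP : Pack K δ (insert (x, y) Z) := by
    refine ⟨?_, ?_, ?_, ?_, ?_⟩
    · intro z hz
      rcases Finset.mem_insert.1 hz with rfl | hz
      · exact hx
      · exact hZ.mem z hz
    · intro z hz
      rcases Finset.mem_insert.1 hz with rfl | hz
      · exact hyp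
      · exact hZ.mem' z hz
    · intro z hz
      rcases Finset.mem_insert.1 hz with rfl | hz
      · exact hxy
      · exact hZ.one z hz
    · rw [Finset.coe_insert]
      exact hZ.disj.insert fun z hz _ => hA z hz
    · rw [Finset.coe_insert]
      exact hZ.disj'.insert fun z hz _ => hB z hz
  have := hmax _ hP
  rw [Finset.card_insert_of_notMem hmem] at this
  omega

theorem hull_cover (hn : 1 ≤ n) (K : Set (EuclideanSpace ℝ (Fin n))) (δ : ℝ) (Y : Finset (EuclideanSpace ℝ (Fin n)))
    (hY : ∀ v : EuclideanSpace ℝ (Fin n), v ≠ 0 → ∃ z ∈ Y, ∀ p ∈ K, (1 - δ) * inner ℝ p v ≤ inner ℝ z v) :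
    (1 - δ) • K ⊆ convexHull ℝ (Y : Set (EuclideanSpace ℝ (Fin n))) := by
  rintro _ ⟨p, hp, rfl⟩
  by_contra hnot
  obtain ⟨f, u, hf, hu⟩ := geometric_hahn_banach_closed_point (convex_convexHull ℝ _)
    (Y.finite_toSet.isCompact_convexHull ℝ).isClosed hnot
  set v := (InnerProductSpace.toDual ℝ (EuclideanSpace ℝ (Fin n))).symm f with hv
  have hfv : ∀ w, f w = inner ℝ w v := by
    intro w
    rw [real_inner_comm, hv, InnerProductSpace.toDual_symm_apply]
  by_cases h0 : v = 0
  · have : ∃ w : EuclideanSpace ℝ (Fin n), w ≠ 0 := by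
      refine ⟨EuclideanSpace.single ⟨0, hn⟩ 1, ?_⟩
      simp
    obtain ⟨w, hw⟩ := this
    obtain ⟨z, hz, _⟩ := hY w hw
    have h1 := hf z (subset_convexHull ℝ _ hz)
    rw [hfv, h0, inner_zero_right] at h1 hu
    linarith
  · obtain ⟨z, hz, hzp⟩ := hY v h0
    have h1 := hf z (subset_convexHull ℝ _ hz)
    have h2 := hzp p hp
    rw [hfv] at h1 hu
    simp only [real_inner_smul_left] at hu
    linarith

theorem const_bound (hn : 1 ≤ n) (N Q ε : ℝ) (hN : 0 ≤ N) (hQ : 1 ≤ Q) (h0 : 0 < ε)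
    (h : N^2 * ε^(n-1) ≤ n^2 * Q^n) : N ≤ (2 * Q)^n * ε ^ (-(((n : ℝ) - 1) / 2)) := by
  have hr : (ε ^ (-(((n : ℝ) - 1) / 2)))^2 * ε^(n-1) = 1 := by
    rw [← Real.rpow_natCast, ← Real.rpow_natCast, ← Real.rpow_mul h0.le, ← Real.rpow_add h0]
    rw [Nat.cast_sub hn]
    convert Real.rpow_zero ε using 2
    push_cast; ring
  have hn2 : (n : ℝ) ≤ 2^n := by exact_mod_cast (Nat.lt_two_pow_self (n := n)).le
  have hQ2 : Q^n ≤ (Q^n)^2 := by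
    have := one_le_pow₀ hQ (n := n)
    nlinarith
  have hpos : 0 ≤ (2 * Q)^n * ε ^ (-(((n : ℝ) - 1) / 2)) := by positivity
  refine le_of_sq_le_sq ?_ hpos
  refine le_of_mul_le_mul_right ?_ (pow_pos h0 (n-1))
  rw [mul_pow, mul_assoc ((( 2 * Q)^n)^2), hr, mul_one, mul_pow, mul_pow]
  refine h.trans ?_
  gcongr

end final

/-- There exists an absolute constant `C > 0` such that for every dimension `d ≥ 1`,
every convex body `K` in `ℝ^d` whose center of mass is at the origin, and every
`ε ∈ (0, 1/2)`, there is a convex polytope `P = conv Y` with at most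
`C^d * ε^{-(d-1)/2}` vertices such that `(1-ε)K ⊆ P ⊆ K`. -/
theorem stmt0 :
    ∃ C : ℝ, 0 < C ∧ ∀ d : ℕ, 1 ≤ d →
      ∀ K : Set (EuclideanSpace ℝ (Fin d)),
        IsCompact K → Convex ℝ K → (interior K).Nonempty →
        (∫ x in K, x) = 0 →
        ∀ ε : ℝ, 0 < ε → ε < 1 / 2 →
          ∃ Y : Finset (EuclideanSpace ℝ (Fin d)),
            (Y.card : ℝ) ≤ C ^ d * ε ^ (-(((d : ℝ) - 1) / 2)) ∧
            (1 - ε) • K ⊆ convexHull ℝ (Y : Set (EuclideanSpace ℝ (Fin d))) ∧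
            convexHull ℝ (Y : Set (EuclideanSpace ℝ (Fin d))) ⊆ K := by
  refine ⟨2 * (48 * 16 * 24 * Real.exp 7), by positivity, ?_⟩
  intro d hd K hK hc hi hcen ε h0 h1
  classical
  have hnh := zero_nhds K hK hc hi hcen
  obtain ⟨Z, hZ, hmax⟩ := exists_max_pack hd K hK hc hnh hcen ε h0 (by linarith)
  have hcov := pack_cover K hK hnh ε h0 (by linarith) Z hZ hmax
  refine ⟨Z.image Prod.fst, ?_, ?_, ?_⟩
  · refine le_trans (Nat.cast_le.2 Finset.card_image_le) ?_
    refine const_bound hd _ _ ε (Nat.cast_nonneg _) ?_ h0 (pack_card hd K hK hc hnh hcen ε h0 (by linarith) Z hZ)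
    have := Real.add_one_le_exp 7
    linarith
  · refine hull_cover hd K ε _ fun v hv => ?_
    obtain ⟨z, hz, h⟩ := hcov v hv
    exact ⟨z.1, Finset.mem_image_of_mem _ hz, h⟩
  · refine convexHull_min ?_ hc
    intro p hp
    obtain ⟨z, hz, rfl⟩ := Finset.mem_image.1 (Finset.mem_coe.1 hp)
    exact hZ.mem z hz
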